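/- arXiv:1804.02776 — 2 statements merged into one kernel-verified Lean document; each statement's English description precedes it below -/
import Mathlib

section
/- For every ε > 0 there exists N ∈ ℕ such that for every n ≥ N, every non-negative conjugation-invariant function α : S_n → ℝ, and every irreducible complex character χ of S_n other than the trivial and sign characters: Σ_{σ ∈ S_n} α(σ)·(1 - χ̃(σ)) ≥ (1 - ε)·Σ_{σ ∈ S_n} α(σ)·(1 - (c₁(σ)-1)/(n-1)). (Equivalently: for every non-negative normal element Σ ∈ ℝ[S_n], the spectral gap |Σ| - λ(S_n, Σ) is at least the spectral gap of the standard representation, [|Σ| - λ₁(std(Σ))], multiplied by a factor 1 - o_n(1).) -/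
open CategoryTheory

/-- `c₁(σ)`: the number of fixed points of a permutation. -/
def fixCount {n : ℕ} (σ : Equiv.Perm (Fin n)) : ℕ :=
  (Finset.univ.filter fun x => σ x = x).card

/-- `c_ℓ(σ)`: the number of `ℓ`-cycles of a permutation (for `ℓ ≥ 2`). -/
def cyc {n : ℕ} (ℓ : ℕ) (σ : Equiv.Perm (Fin n)) : ℕ :=
  Multiset.count ℓ σ.cycleType

/-- The (real-valued) normalized character `χ̃(σ) = χ(σ)/χ(1)` of `V` at `σ`. -/
noncomputable def normChar {n : ℕ} (V : FDRep ℂ (Equiv.Perm (Fin n)))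
    (σ : Equiv.Perm (Fin n)) : ℝ :=
  (V.character σ / V.character 1).re

/-- `V` is an irreducible representation whose character is neither the trivial
character nor the sign character. -/
def IsNontrivIrr {n : ℕ} (V : FDRep ℂ (Equiv.Perm (Fin n))) : Prop :=
  Simple V ∧ V.character ≠ (fun _ => 1) ∧
    V.character ≠ (fun σ => ((Equiv.Perm.sign σ : ℤ) : ℂ))

/-- The maximum of the normalized characters `F₁(σ), …, F₈(σ)` at `σ` of the eight
irreps `EIGHT_n = {(n-1,1), (n-2,2), (n-3,3), (n-3,2,1), (n-4,4),
(n-1,1)ᵗ, (n-2,2)ᵗ, (n-2,1,1)ᵗ}`. -/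
noncomputable def maxF (n : ℕ) (σ : Equiv.Perm (Fin n)) : ℝ :=
  let c1 : ℝ := fixCount σ
  let c2 : ℝ := cyc 2 σ
  let c3 : ℝ := cyc 3 σ
  let c4 : ℝ := cyc 4 σ
  let e : ℝ := ((Equiv.Perm.sign σ : ℤ) : ℝ)
  let N : ℝ := n
  let F1 := (c1 - 1) / (N - 1)
  let F2 := (c1 * (c1 - 3) / 2 + c2) / (N * (N - 3) / 2)
  let F3 := (c1 * (c1 - 1) * (c1 - 5) / 6 + (c1 - 1) * c2 + c3) / (N * (N - 1) * (N - 5) / 6)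
  let F4 := (c1 * (c1 - 2) * (c1 - 4) / 3 - c3) / (N * (N - 2) * (N - 4) / 3)
  let F5 := (c1 * (c1 - 1) * (c1 - 2) * (c1 - 7) / 24 + (c1 ^ 2 - 3 * c1 - 1) * c2 / 2
      + c2 ^ 2 / 2 + (c1 - 1) * c3 + c4) / (N * (N - 1) * (N - 2) * (N - 7) / 24)
  let F6 := e * F1
  let F7 := e * F2
  let F8 := e * ((c1 - 1) * (c1 - 2) / 2 - c2) / ((N - 1) * (N - 2) / 2)
  max (max (max F1 F2) (max F3 F4)) (max (max F5 F6) (max F7 F8))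

open scoped BigOperators
open Equiv (Perm swap)

section Permutations

variable {α : Type*} [Fintype α] [DecidableEq α]

lemma expect_mul_right_perm {f : Perm α → ℝ} (h : Perm α) : 𝔼 x, f (x * h) = 𝔼 x, f x :=
  Fintype.expect_equiv (Equiv.mulRight h) _ _ fun _ => rfl

lemma expect_mul_left_perm {f : Perm α → ℝ} (h : Perm α) : 𝔼 x, f (h * x) = 𝔼 x, f x :=
  Fintype.expect_equiv (Equiv.mulLeft h) _ _ fun _ => rfl

lemma expect_perm_apply [Nonempty α] (f : α → ℝ) (a : α) :
    𝔼 x : Perm α, f (x a) = 𝔼 i, f i := by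
  have h (b : α) : 𝔼 x : Perm α, f (x b) = 𝔼 x : Perm α, f (x a) := by
    rw [← expect_mul_right_perm (swap a b)]
    simp
  calc 𝔼 x : Perm α, f (x a) = 𝔼 b : α, 𝔼 x : Perm α, f (x b) := by
        simp_rw [h, Fintype.expect_const]
    _ = 𝔼 x : Perm α, 𝔼 b, f (x b) := Finset.expect_comm _ _ _
    _ = 𝔼 x : Perm α, 𝔼 b, f b :=
        Finset.expect_congr rfl fun x _ => Fintype.expect_equiv x _ _ fun _ => rfl
    _ = 𝔼 b, f b := Fintype.expect_const _

lemma expect_not_disjoint_conj_le [Nonempty α] (g k : Perm α) :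
    𝔼 y : Perm α, (if Disjoint g.support (y * k * y⁻¹).support then (0 : ℝ) else 1) ≤
      g.support.card * k.support.card / Fintype.card α := by
  have key (y : Perm α) : (if Disjoint g.support (y * k * y⁻¹).support then (0 : ℝ) else 1) ≤
      ∑ b ∈ k.support, ∑ a ∈ g.support, if y b = a then 1 else 0 := by
    split_ifs with hd
    · positivity
    · rw [Equiv.Perm.support_conj, Finset.not_disjoint_iff] at hd
      obtain ⟨a, ha, hb⟩ := hd
      obtain ⟨b, hb', rfl⟩ := Finset.mem_map.1 hb
      refine le_trans ?_ (Finset.single_le_sum (fun i _ => by positivity) hb')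
      refine le_trans ?_ (Finset.single_le_sum (fun i _ => by positivity) ha)
      simp
  refine (Finset.expect_le_expect fun y _ => key y).trans (le_of_eq ?_)
  rw [Finset.expect_sum_comm]
  have hp (a b : α) : 𝔼 y : Perm α, (if y b = a then (1 : ℝ) else 0) =
      1 / Fintype.card α := by
    rw [expect_perm_apply (fun i => if i = a then (1 : ℝ) else 0)]
    simp
  simp_rw [Finset.expect_sum_comm, hp]
  simp
  ring

end Permutations

/-- An isometric action of a symmetric group on which every class sum acts by a scalar. -/
structure IsFactorRep {α E : Type*} [Fintype α] [DecidableEq α] [NormedAddCommGroup E]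
    [InnerProductSpace ℝ E] (ρ : Perm α →* (E →ₗ[ℝ] E)) (φ : Perm α → ℝ) : Prop where
  norm_map : ∀ g v, ‖ρ g v‖ = ‖v‖
  expect_inner : ∀ g v w, 𝔼 x, inner ℝ v (ρ (x * g * x⁻¹) w) = φ g * inner ℝ v w

namespace IsFactorRep

variable {α E : Type*} [Fintype α] [DecidableEq α] [NormedAddCommGroup E]
  [InnerProductSpace ℝ E] {ρ : Perm α →* (E →ₗ[ℝ] E)} {φ : Perm α → ℝ}

lemma inner_map_map (h : IsFactorRep ρ φ) (g : Perm α) (v w : E) :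
    inner ℝ (ρ g v) (ρ g w) = inner ℝ v w :=
  (⟨ρ g, h.norm_map g⟩ : E →ₗᵢ[ℝ] E).inner_map_map v w

omit [Fintype α] [DecidableEq α] in
lemma map_mul_apply (g k : Perm α) (v : E) : ρ (g * k) v = ρ g (ρ k v) := by
  rw [map_mul]; rfl

omit [Fintype α] [DecidableEq α] in
lemma map_inv_apply (g : Perm α) (v : E) : ρ g (ρ g⁻¹ v) = v := by
  rw [← map_mul_apply]; simp

lemma inner_map_left (h : IsFactorRep ρ φ) (g : Perm α) (v w : E) :
    inner ℝ (ρ g v) w = inner ℝ v (ρ g⁻¹ w) := by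
  rw [← h.inner_map_map g v, map_inv_apply]

lemma abs_inner_map_le (h : IsFactorRep ρ φ) (g : Perm α) {v : E} (hv : ‖v‖ = 1) :
    |inner ℝ v (ρ g v)| ≤ 1 := by
  simpa [h.norm_map, hv] using abs_real_inner_le_norm v (ρ g v)

lemma norm_sub_map_sq (h : IsFactorRep ρ φ) (g : Perm α) {v : E} (hv : ‖v‖ = 1) :
    ‖v - ρ g v‖ ^ 2 = 2 * (1 - inner ℝ v (ρ g v)) := by
  rw [norm_sub_sq_real, h.norm_map, hv]; ring

lemma eq_expect (h : IsFactorRep ρ φ) (g : Perm α) {v : E} (hv : ‖v‖ = 1) :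
    φ g = 𝔼 x, inner ℝ v (ρ (x * g * x⁻¹) v) := by
  rw [h.expect_inner, real_inner_self_eq_norm_sq, hv]; ring

variable [Nontrivial E]

lemma abs_le_one (h : IsFactorRep ρ φ) (g : Perm α) : |φ g| ≤ 1 := by
  obtain ⟨v, hv⟩ := exists_norm_eq E zero_le_one
  rw [h.eq_expect g hv]
  exact (Finset.abs_expect_le _ _).trans
    (Finset.expect_le Finset.univ_nonempty fun x _ => h.abs_inner_map_le _ hv)

lemma apply_one (h : IsFactorRep ρ φ) : φ 1 = 1 := by
  obtain ⟨v, hv⟩ := exists_norm_eq E zero_le_one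
  rw [h.eq_expect 1 hv]
  simp [hv]

lemma apply_conj (h : IsFactorRep ρ φ) (g y : Perm α) : φ (y * g * y⁻¹) = φ g := by
  obtain ⟨v, hv⟩ := exists_norm_eq E zero_le_one
  rw [h.eq_expect _ hv, h.eq_expect g hv,
    ← expect_mul_right_perm (f := fun x => inner ℝ v (ρ (x * g * x⁻¹) v)) y]
  simp [mul_assoc]

lemma eq_of_cycleType (h : IsFactorRep ρ φ) {g k : Perm α} (hgk : g.cycleType = k.cycleType) :
    φ g = φ k := by
  obtain ⟨y, rfl⟩ := isConj_iff.1 (Equiv.Perm.isConj_iff_cycleType_eq.2 hgk)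
  rw [h.apply_conj]

lemma apply_inv (h : IsFactorRep ρ φ) (g : Perm α) : φ g⁻¹ = φ g :=
  h.eq_of_cycleType (Equiv.Perm.cycleType_inv g)

lemma mul_eq_expect (h : IsFactorRep ρ φ) (g k : Perm α) :
    φ g * φ k = 𝔼 y, φ (g * (y * k * y⁻¹)) := by
  obtain ⟨v, hv⟩ := exists_norm_eq E zero_le_one
  calc φ g * φ k = 𝔼 z, φ g * inner ℝ v (ρ (z * k * z⁻¹) v) := by
        rw [h.eq_expect k hv, Finset.mul_expect]
    _ = 𝔼 z, 𝔼 x, inner ℝ v (ρ (x * g * x⁻¹ * (z * k * z⁻¹)) v) := by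
        simp_rw [← h.expect_inner, ← map_mul_apply]
    _ = 𝔼 x, 𝔼 z, inner ℝ v (ρ (x * g * x⁻¹ * (z * k * z⁻¹)) v) := Finset.expect_comm _ _ _
    _ = 𝔼 x, 𝔼 y, inner ℝ v (ρ (x * (g * (y * k * y⁻¹)) * x⁻¹) v) := by
        refine Finset.expect_congr rfl fun x _ => ?_
        rw [← expect_mul_left_perm x]
        simp [mul_assoc]
    _ = 𝔼 y, 𝔼 x, inner ℝ v (ρ (x * (g * (y * k * y⁻¹)) * x⁻¹) v) := Finset.expect_comm _ _ _
    _ = 𝔼 y, φ (g * (y * k * y⁻¹)) := by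
        simp_rw [← h.eq_expect _ hv]

lemma abs_mul_sub_le [Nonempty α] (h : IsFactorRep ρ φ) {g k w : Perm α}
    (hw : w.cycleType = g.cycleType + k.cycleType) :
    |φ g * φ k - φ w| ≤ 2 * (g.support.card * k.support.card / Fintype.card α) := by
  rw [h.mul_eq_expect, ← Fintype.expect_const (ι := Perm α) (φ w), ← Finset.expect_sub_distrib]
  refine (Finset.abs_expect_le _ _).trans
    (le_trans ?_ (mul_le_mul_of_nonneg_left (expect_not_disjoint_conj_le g k) zero_le_two))
  rw [Finset.mul_expect]
  refine Finset.expect_le_expect fun y _ => ?_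
  split_ifs with hd
  · rw [h.eq_of_cycleType (k := w), sub_self, abs_zero, mul_zero]
    rw [(Equiv.Perm.disjoint_iff_disjoint_support.2 hd).cycleType_mul,
      Equiv.Perm.cycleType_conj, hw]
  · have h1 := abs_le.1 (h.abs_le_one w)
    have h2 := abs_le.1 (h.abs_le_one (g * (y * k * y⁻¹)))
    rw [abs_le]
    constructor <;> linarith

lemma one_sub_mul_le (h : IsFactorRep ρ φ) (g k : Perm α) :
    1 - φ (g * k) ≤ 2 * (1 - φ g) + 2 * (1 - φ k) := by
  obtain ⟨v, hv⟩ := exists_norm_eq E zero_le_one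
  have key (x : Perm α) : 1 - inner ℝ v (ρ (x * (g * k) * x⁻¹) v) ≤
      2 * (1 - inner ℝ v (ρ (x * g * x⁻¹) v)) + 2 * (1 - inner ℝ v (ρ (x * k * x⁻¹) v)) := by
    have e : x * (g * k) * x⁻¹ = (x * g * x⁻¹) * (x * k * x⁻¹) := by group
    have h1 := norm_sub_le_norm_sub_add_norm_sub v (ρ (x * g * x⁻¹) v)
      (ρ (x * (g * k) * x⁻¹) v)
    have h2 : ‖ρ (x * g * x⁻¹) v - ρ (x * (g * k) * x⁻¹) v‖ = ‖v - ρ (x * k * x⁻¹) v‖ := by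
      rw [e, map_mul_apply (x * g * x⁻¹), ← map_sub, h.norm_map]
    rw [h2] at h1
    have h3 := h.norm_sub_map_sq (x * g * x⁻¹) hv
    have h4 := h.norm_sub_map_sq (x * k * x⁻¹) hv
    have h5 := h.norm_sub_map_sq (x * (g * k) * x⁻¹) hv
    nlinarith [sq_nonneg (‖v - ρ (x * g * x⁻¹) v‖ - ‖v - ρ (x * k * x⁻¹) v‖),
      norm_nonneg (v - ρ (x * (g * k) * x⁻¹) v)]
  have := Finset.expect_le_expect (s := Finset.univ) fun x _ => key x
  simpa only [Finset.expect_add_distrib, ← Finset.mul_expect, Finset.expect_sub_distrib,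
    ← h.eq_expect _ hv, Fintype.expect_const] using this

lemma sq_le_of_family (h : IsFactorRep ρ φ) {m : ℕ} (hm : 0 < m) (u : Fin m → Perm α)
    (σ : Perm α) {a b : ℝ} (hu : ∀ i, φ (u i) = a) (hb : -1 ≤ b)
    (huu : ∀ i j, i ≠ j → φ (u i * (u j)⁻¹) ≤ b) (hs : ∀ i, φ (u i * σ) = φ σ) :
    ((1 - a) * φ σ) ^ 2 ≤ 2 / m + (b - a ^ 2) := by
  obtain ⟨v, hv⟩ := exists_norm_eq E zero_le_one
  let r (x g : Perm α) : E := ρ (x * g * x⁻¹) v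
  let D (x : Perm α) : E := ∑ i, (r x (u i)⁻¹ - a • v)
  have hr (x g k : Perm α) : inner ℝ (r x g) (r x k) = inner ℝ v (r x (g⁻¹ * k)) := by
    simp only [r]
    rw [h.inner_map_left, ← map_mul_apply]
    congr 3
    group
  have hvv : inner ℝ v v = (1 : ℝ) := by rw [real_inner_self_eq_norm_sq, hv]; norm_num
  have hφ (g : Perm α) : 𝔼 x, inner ℝ v (r x g) = φ g := (h.eq_expect g hv).symm
  have hφ' (g : Perm α) : 𝔼 x, inner ℝ (r x g) v = φ g := by
    simp_rw [real_inner_comm, hφ]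
  have hDσ : 𝔼 x, inner ℝ (D x) (r x σ) = m * ((1 - a) * φ σ) := by
    simp only [D, sum_inner, inner_sub_left, real_inner_smul_left, hr, inv_inv,
      Finset.expect_sum_comm, Finset.expect_sub_distrib, ← Finset.mul_expect, hφ, hs]
    simp
    ring
  have hu2 (i j : Fin m) : 𝔼 x, inner ℝ (r x (u i)⁻¹ - a • v) (r x (u j)⁻¹ - a • v) =
      φ (u i * (u j)⁻¹) - a ^ 2 := by
    simp only [inner_sub_left, inner_sub_right, real_inner_smul_left, real_inner_smul_right, hr,
      inv_inv, Finset.expect_sub_distrib, ← Finset.mul_expect, hφ, hφ', h.apply_inv, hu, hvv,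
      Fintype.expect_const]
    ring
  have hDD : 𝔼 x, ‖D x‖ ^ 2 = ∑ i, ∑ j, (φ (u i * (u j)⁻¹) - a ^ 2) := by
    simp only [D, ← real_inner_self_eq_norm_sq, sum_inner, inner_sum, Finset.expect_sum_comm, hu2]
    exact Finset.sum_comm
  have hle : ∑ i, ∑ j, (φ (u i * (u j)⁻¹) - a ^ 2) ≤ m ^ 2 * (2 / m + (b - a ^ 2)) := by
    calc ∑ i, ∑ j, (φ (u i * (u j)⁻¹) - a ^ 2)
        ≤ ∑ i : Fin m, ∑ j : Fin m, ((b - a ^ 2) + if i = j then 2 else 0) := by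
          refine Finset.sum_le_sum fun i _ => Finset.sum_le_sum fun j _ => ?_
          split_ifs with hij
          · have := (abs_le.1 (h.abs_le_one (u i * (u j)⁻¹))).2
            linarith
          · have := huu i j hij
            linarith
      _ = m ^ 2 * (2 / m + (b - a ^ 2)) := by
          simp [Finset.sum_add_distrib]
          field_simp
          ring
  have hCS : (m * ((1 - a) * φ σ)) ^ 2 ≤ 𝔼 x, ‖D x‖ ^ 2 := by
    rw [← hDσ]
    have := Finset.expect_mul_sq_le_sq_mul_sq Finset.univ (fun x => inner ℝ (D x) (r x σ))
      fun _ => (1 : ℝ)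
    simp only [mul_one, one_pow, Fintype.expect_const] at this
    refine this.trans (Finset.expect_le_expect fun x _ => ?_)
    rw [← sq_abs]
    refine pow_le_pow_left₀ (abs_nonneg _) ?_ 2
    simpa [r, h.norm_map, hv] using abs_real_inner_le_norm (D x) (r x σ)
  have hm' : (0 : ℝ) < m ^ 2 := by positivity
  refine le_of_mul_le_mul_left ?_ hm'
  calc (m : ℝ) ^ 2 * ((1 - a) * φ σ) ^ 2 = (m * ((1 - a) * φ σ)) ^ 2 := by ring
    _ ≤ _ := (hCS.trans hDD.le).trans hle

end IsFactorRep

section Commutators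

variable {α : Type*} [Fintype α] [DecidableEq α]

lemma exists_subset_support_forall_apply_ne (σ : Perm α) (r : ℕ)
    (hr : 3 * r ≤ σ.support.card) :
    ∃ A : Finset α, A.card = r ∧ A ⊆ σ.support ∧ ∀ a ∈ A, ∀ b ∈ A, σ a ≠ b := by
  induction r with
  | zero => exact ⟨∅, by simp⟩
  | succ r ih =>
    obtain ⟨A, hA, hAσ, hne⟩ := ih (by omega)
    have hcard : (A ∪ (A.image σ ∪ A.image ⇑σ⁻¹)).card < σ.support.card := by
      have h1 := Finset.card_union_le A (A.image σ ∪ A.image ⇑σ⁻¹)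
      have h2 := Finset.card_union_le (A.image σ) (A.image ⇑σ⁻¹)
      have h3 := Finset.card_image_le (s := A) (f := σ)
      have h4 := Finset.card_image_le (s := A) (f := ⇑σ⁻¹)
      omega
    obtain ⟨a, haσ, ha⟩ := Finset.exists_mem_notMem_of_card_lt_card hcard
    simp only [Finset.mem_union, Finset.mem_image, not_or, not_exists, not_and] at ha
    obtain ⟨ha, ha1, ha2⟩ := ha
    refine ⟨insert a A, by rw [Finset.card_insert_of_notMem ha, hA],
      Finset.insert_subset haσ hAσ, ?_⟩
    have haσ' := Equiv.Perm.mem_support.1 haσ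
    intro x hx y hy hxy
    rcases Finset.mem_insert.1 hx with rfl | hx <;> rcases Finset.mem_insert.1 hy with rfl | hy
    · exact haσ' hxy
    · exact ha2 y hy (by rw [← hxy]; simp)
    · exact ha1 x ‹_› hxy
    · exact hne x hx y hy hxy

lemma exists_disjoint_double_transpositions (σ : Perm α) (m : ℕ)
    (hm : 6 * m ≤ σ.support.card) :
    ∃ u : Fin m → Perm α, (∀ i, (u i).cycleType = {2, 2}) ∧
      (∀ i j, i ≠ j → (u i).Disjoint (u j)) ∧ ∀ i, ∃ g, u i * σ = g * σ * g⁻¹ := by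
  obtain ⟨A, hA, hAσ, hne⟩ := exists_subset_support_forall_apply_ne σ (2 * m) (by omega)
  obtain ⟨f⟩ : Nonempty (Fin m ⊕ Fin m ↪ A) :=
    Function.Embedding.nonempty_of_card_le (by simp [hA]; omega)
  have hff (x y : Fin m ⊕ Fin m) : σ (f x) ≠ f y := hne _ (f x).2 _ (f y).2
  have hinj (x y : Fin m ⊕ Fin m) : (f x : α) = f y ↔ x = y := by
    rw [Subtype.coe_inj, f.injective.eq_iff]
  refine ⟨fun i : Fin m => swap (f (.inl i) : α) (f (.inr i)) *
    swap (σ (f (.inl i))) (σ (f (.inr i))), fun i => ?_, fun i j hij => ?_, fun i => ?_⟩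
  · refine Equiv.Perm.cycleType_swap_mul_swap_of_nodup ?_
    simp [hinj, (hff _ _).symm]
  · refine Equiv.Perm.Disjoint.mul_left (Equiv.Perm.Disjoint.mul_right ?_ ?_)
      (Equiv.Perm.Disjoint.mul_right ?_ ?_) <;> refine Equiv.Perm.disjoint_swap_swap ?_ <;>
      simp [hinj, hff, (hff _ _).symm, hij]
  · refine ⟨swap (f (.inl i) : α) (f (.inr i)), ?_⟩
    rw [Equiv.swap_inv, mul_assoc, mul_assoc, Equiv.mul_swap_eq_swap_mul]

omit [Fintype α] in
lemma swap_commutator_mul_swap_commutator {a e b d : α} (h : [a, e, b, d].Nodup) :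
    (swap a b * swap e b) * (swap a d * swap e d) = swap e b * swap a d := by
  ext x
  simp only [List.nodup_cons, List.mem_cons, List.not_mem_nil, or_false, not_or] at h
  simp only [Equiv.Perm.mul_apply, Equiv.swap_apply_def]
  grind

end Commutators

namespace IsFactorRep

variable {α E : Type*} [Fintype α] [DecidableEq α] [NormedAddCommGroup E]
  [InnerProductSpace ℝ E] {ρ : Perm α →* (E →ₗ[ℝ] E)} {φ : Perm α → ℝ} [Nontrivial E]

lemma sq_le_of_le_card_support (h : IsFactorRep ρ φ) {m : ℕ} (hm : 0 < m) {σ d : Perm α}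
    (hσ : 6 * m ≤ σ.support.card) (hd : d.cycleType = {2, 2}) :
    ((1 - φ d) * φ σ) ^ 2 ≤ 2 / m + 32 / Fintype.card α := by
  obtain ⟨u, hu, huu, hg⟩ := exists_disjoint_double_transpositions σ m hσ
  have : Nonempty α := by
    obtain ⟨x, -⟩ := Finset.card_pos.1 (show 0 < σ.support.card by omega)
    exact ⟨x⟩
  have hcard (i : Fin m) : (u i).support.card = 4 := by
    rw [← Equiv.Perm.sum_cycleType, hu]; rfl
  have hdu (i : Fin m) : φ (u i) = φ d := h.eq_of_cycleType (by rw [hu, hd])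
  convert h.sq_le_of_family hm u σ (a := φ d) (b := φ d ^ 2 + 32 / Fintype.card α) hdu
    ?_ ?_ ?_ using 2
  · ring
  · have : (0 : ℝ) ≤ 32 / Fintype.card α := by positivity
    nlinarith [sq_nonneg (φ d)]
  · intro i j hij
    have := h.abs_mul_sub_le (huu i j hij).inv_right.cycleType_mul
    rw [h.apply_inv, hdu, hdu, Equiv.Perm.support_inv, hcard, hcard] at this
    have h1 := (abs_le.1 this).1
    have e : (2 : ℝ) * ((4 : ℕ) * (4 : ℕ) / Fintype.card α) = 32 / Fintype.card α := by
      push_cast; ring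
    rw [e] at h1
    linarith
  · intro i
    obtain ⟨g, hg⟩ := hg i
    rw [hg, h.apply_conj]

lemma le_swap_sq_add (h : IsFactorRep ρ φ) {d : Perm α} (hd : d.cycleType = {2, 2}) {p q : α}
    (hpq : p ≠ q) : φ d ≤ φ (swap p q) ^ 2 + 8 / Fintype.card α := by
  have : Nonempty α := ⟨p⟩
  have hs : (swap p q).cycleType = {2} :=
    Equiv.Perm.isSwap_iff_cycleType.1 (Equiv.Perm.swap_isSwap_iff.2 hpq)
  have := h.abs_mul_sub_le (g := swap p q) (k := swap p q) (w := d) (by rw [hs, hd]; rfl)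
  rw [Equiv.Perm.card_support_swap hpq] at this
  have h1 := (abs_le.1 this).1
  have e : (2 : ℝ) * ((2 : ℕ) * (2 : ℕ) / Fintype.card α) = 8 / Fintype.card α := by
    push_cast; ring
  rw [e] at h1
  linarith

lemma one_sub_le_of_fixed (h : IsFactorRep ρ φ) {σ d : Perm α} (hd : d.cycleType = {2, 2})
    (hσ : σ ≠ 1) (hfix : σ.support.card + 2 ≤ Fintype.card α) :
    1 - φ d ≤ 16 * (1 - φ σ) := by
  obtain ⟨a, ha⟩ : ∃ a, σ a ≠ a := by
    by_contra! hc
    exact hσ (Equiv.ext hc)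
  obtain ⟨x, hx, y, hy, hxy⟩ : ∃ x ∈ σ.supportᶜ, ∃ y ∈ σ.supportᶜ, x ≠ y :=
    Finset.one_lt_card.1 (by rw [Finset.card_compl]; omega)
  simp only [Finset.mem_compl, Equiv.Perm.mem_support, not_not] at hx hy
  have hcomm (b : α) (hb : σ b = b) : 1 - φ (swap a b * swap (σ a) b) ≤ 4 * (1 - φ σ) := by
    have e : swap a b * swap (σ a) b = (swap a b * σ * (swap a b)⁻¹) * σ⁻¹ := by
      rw [Equiv.swap_inv, mul_assoc (swap a b), Equiv.mul_swap_eq_swap_mul σ, hb]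
      group
    have := h.one_sub_mul_le (swap a b * σ * (swap a b)⁻¹) σ⁻¹
    rw [← e, h.apply_conj, h.apply_inv] at this
    linarith
  have hnd : [a, σ a, x, y].Nodup := by
    simp only [List.nodup_cons, List.mem_cons, List.not_mem_nil, or_false, not_or]
    grind [σ.injective]
  have hnd' : [σ a, x, a, y].Nodup := by
    simp only [List.nodup_cons, List.mem_cons, List.not_mem_nil, or_false, not_or] at hnd ⊢
    grind
  have h1 := h.one_sub_mul_le (swap a x * swap (σ a) x) (swap a y * swap (σ a) y)
  rw [swap_commutator_mul_swap_commutator hnd, h.eq_of_cycleType (k := d)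
    (by rw [hd, Equiv.Perm.cycleType_swap_mul_swap_of_nodup hnd'])] at h1
  linarith [hcomm x hx, hcomm y hy]

end IsFactorRep

section Distribution

variable {α : Type*} [Fintype α] [DecidableEq α]

lemma expect_apply_ne_perm [Nonempty α] (σ : Perm α) :
    𝔼 a, (if σ a = a then (1 : ℝ) else 0) = 1 - σ.support.card / Fintype.card α := by
  have h : (Finset.univ.filter fun a => σ a = a).card + σ.support.card = Fintype.card α := by
    rw [← Finset.card_univ, Equiv.Perm.support]
    exact Finset.card_filter_add_card_filter_not _
  have h' : ((Finset.univ.filter fun a => σ a = a).card : ℝ) + σ.support.card =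
    Fintype.card α := by exact_mod_cast h
  have h0 : (Fintype.card α : ℝ) ≠ 0 := by positivity
  rw [Fintype.expect_eq_sum_div_card, Finset.sum_boole]
  field_simp
  linarith

lemma expect_conj_apply_perm (σ : Perm α) (p : α) (hα : 2 ≤ Fintype.card α) (f : α → ℝ) :
    𝔼 x : Perm α, f ((x * σ * x⁻¹) p) = (1 - σ.support.card / Fintype.card α) * f p +
      σ.support.card / Fintype.card α / (Fintype.card α - 1) *
        ∑ j ∈ Finset.univ.erase p, f j := by
  have : Nonempty α := ⟨p⟩
  let W (j : α) : ℝ := 𝔼 x : Perm α, if (x * σ * x⁻¹) p = j then (1 : ℝ) else 0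
  have hf : 𝔼 x : Perm α, f ((x * σ * x⁻¹) p) = ∑ j, W j * f j := by
    have e (i : α) : ∑ j, (if i = j then (1 : ℝ) else 0) * f j = f i := by simp
    simp_rw [W, Finset.expect_mul, ← Finset.expect_sum_comm, e]
  have hsum : ∑ j, W j = 1 := by
    have e (i : α) : ∑ j, (if i = j then (1 : ℝ) else 0) = 1 := by simp
    simp_rw [W, ← Finset.expect_sum_comm, e, Fintype.expect_const]
  have hp : W p = 1 - σ.support.card / Fintype.card α := by
    rw [← expect_apply_ne_perm, ← expect_perm_apply _ p]
    refine Fintype.expect_equiv (Equiv.inv (Perm α)) _ _ fun x => ?_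
    simp [Equiv.Perm.mul_apply, ← Equiv.Perm.eq_inv_iff_eq]
  have hW (i j : α) (hi : i ≠ p) (hj : j ≠ p) : W i = W j := by
    simp only [W]
    rw [← expect_mul_left_perm (swap i j)]
    refine Finset.expect_congr rfl fun x _ => ?_
    congr 1
    simp only [mul_inv_rev, Equiv.swap_inv, Equiv.Perm.mul_apply,
      Equiv.swap_apply_of_ne_of_ne hi.symm hj.symm, eq_iff_iff]
    rw [Equiv.swap_apply_eq_iff, Equiv.swap_apply_left]
  have hn : (0 : ℝ) < (Fintype.card α : ℝ) - 1 := by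
    have : (2 : ℝ) ≤ Fintype.card α := by exact_mod_cast hα
    linarith
  have hj (j : α) (hj : j ≠ p) :
      W j = σ.support.card / Fintype.card α / (Fintype.card α - 1) := by
    rw [← Finset.add_sum_erase _ _ (Finset.mem_univ p), hp,
      Finset.sum_congr rfl fun i hi => hW i j (Finset.ne_of_mem_erase hi) hj] at hsum
    simp only [Finset.sum_const, Finset.card_erase_of_mem (Finset.mem_univ p), Finset.card_univ,
      nsmul_eq_mul, Nat.cast_sub (one_le_two.trans hα), Nat.cast_one] at hsum
    rw [eq_div_iff hn.ne']
    linarith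
  rw [hf, ← Finset.add_sum_erase _ _ (Finset.mem_univ p), hp, Finset.mul_sum]
  congr 1
  exact Finset.sum_congr rfl fun i hi => by rw [hj i (Finset.ne_of_mem_erase hi)]

end Distribution

namespace IsFactorRep

variable {α E : Type*} [Fintype α] [DecidableEq α] [NormedAddCommGroup E]
  [InnerProductSpace ℝ E] {ρ : Perm α →* (E →ₗ[ℝ] E)} {φ : Perm α → ℝ}

omit [Fintype α] in
lemma exists_swap_apply_eq_neg [Finite α] (hρ : ∃ g v, ρ g v ≠ v) :
    ∃ p q, p ≠ q ∧ ∃ w, ‖w‖ = 1 ∧ ρ (swap p q) w = -w := by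
  have hex : ∃ p q, p ≠ q ∧ ∃ u, ρ (swap p q) u ≠ u := by
    by_contra! hc
    obtain ⟨g, v, hgv⟩ := hρ
    refine hgv ?_
    clear hgv
    induction g using Equiv.Perm.swap_induction_on with
    | one => simp
    | swap_mul g x y hxy ih => rw [map_mul_apply, ih, hc x y hxy]
  obtain ⟨p, q, hpq, u, hu⟩ := hex
  have hw : u - ρ (swap p q) u ≠ 0 := sub_ne_zero.2 hu.symm
  refine ⟨p, q, hpq, ‖u - ρ (swap p q) u‖⁻¹ • (u - ρ (swap p q) u), norm_smul_inv_norm hw, ?_⟩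
  rw [map_smul, map_sub, ← map_mul_apply, Equiv.swap_mul_self, map_one, ← smul_neg, neg_sub]
  rfl

lemma inner_swap_add_inner_swap_le (h : IsFactorRep ρ φ) {p q : α} {w : E}
    (hw : ‖w‖ = 1) (hρ : ρ (swap p q) w = -w) (i : α) :
    inner ℝ w (ρ (swap i p) w) + inner ℝ w (ρ (swap i q) w) ≤ 1 := by
  have hww : inner ℝ w w = (1 : ℝ) := by rw [real_inner_self_eq_norm_sq, hw]; norm_num
  by_cases hip : i = p
  · subst hip
    rw [hρ, Equiv.swap_self, inner_neg_right, ← Equiv.Perm.one_def, map_one]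
    simp
  by_cases hiq : i = q
  · subst hiq
    rw [Equiv.swap_comm, hρ, Equiv.swap_self, inner_neg_right, ← Equiv.Perm.one_def, map_one]
    simp
  by_cases hpq : p = q
  · subst hpq
    have := congrArg (inner ℝ w) hρ
    rw [Equiv.swap_self, ← Equiv.Perm.one_def, map_one, Module.End.one_apply, inner_neg_right,
      hww] at this
    norm_num at this
  have h1 : ρ (swap p q) (ρ (swap i p) w) = -ρ (swap i q) w := by
    rw [← map_mul_apply, Equiv.mul_swap_eq_swap_mul, Equiv.swap_apply_of_ne_of_ne hip hiq,
      Equiv.swap_apply_left, map_mul_apply, hρ, map_neg]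
  have h2 : ρ (swap i p) (ρ (swap i q) w) = ρ (swap p q) (ρ (swap i p) w) := by
    rw [← map_mul_apply, Equiv.mul_swap_eq_swap_mul, Equiv.swap_apply_left,
      Equiv.swap_apply_of_ne_of_ne (Ne.symm hiq) (Ne.symm hpq), map_mul_apply]
  have h3 : inner ℝ w (ρ (swap i p) w) = inner ℝ w (ρ (swap i q) w) := by
    rw [← h.inner_map_map (swap p q), h1, hρ, inner_neg_neg]
  have h4 : inner ℝ (ρ (swap i p) w) (ρ (swap i q) w) = - inner ℝ w (ρ (swap i q) w) := by
    rw [h.inner_map_left, Equiv.swap_inv, h2, h1, inner_neg_right]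
  have h5 : 0 ≤ ‖w - (ρ (swap i p) w + ρ (swap i q) w)‖ ^ 2 := by positivity
  rw [norm_sub_sq_real, norm_add_sq_real, inner_add_right, h.norm_map, h.norm_map, hw, h4, h3]
    at h5
  linarith

/-- The star element at `p`: the sum of the identity and of all transpositions moving `p`. -/
noncomputable def star (ρ : Perm α →* (E →ₗ[ℝ] E)) (p : α) : E →ₗ[ℝ] E := ∑ i, ρ (swap i p)

lemma star_apply (p : α) (v : E) : star ρ p v = ∑ i, ρ (swap i p) v := by
  simp [star, LinearMap.sum_apply]

lemma star_isSymmetric (h : IsFactorRep ρ φ) (p : α) : (star ρ p).IsSymmetric := by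
  intro v w
  simp only [star_apply, sum_inner, inner_sum]
  exact Finset.sum_congr rfl fun i _ => by rw [h.inner_map_left, Equiv.swap_inv]

lemma star_map (τ : Perm α) (p : α) (v : E) : star ρ (τ p) (ρ τ v) = ρ τ (star ρ p v) := by
  rw [star_apply, star_apply, map_sum]
  refine (Fintype.sum_equiv τ _ _ fun i => ?_).symm
  rw [← map_mul_apply, ← map_mul_apply, Equiv.mul_swap_eq_swap_mul]

lemma norm_star_le (h : IsFactorRep ρ φ) (p : α) (v : E) :
    ‖star ρ p v‖ ≤ Fintype.card α * ‖v‖ := by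
  rw [star_apply]
  refine (norm_sum_le _ _).trans ?_
  simp [h.norm_map]

lemma exists_star_eigenvector [FiniteDimensional ℝ E] (h : IsFactorRep ρ φ)
    (hρ : ∃ g v, ρ g v ≠ v) :
    ∃ (p : α) (v : E) (c : ℝ), ‖v‖ = 1 ∧ star ρ p v = c • v ∧ c ≤ (Fintype.card α : ℝ) / 2 := by
  obtain ⟨p, q, -, w, hw, hpq⟩ := exists_swap_apply_eq_neg hρ
  have hw0 : w ≠ 0 := by rintro rfl; simp at hw
  have : Nontrivial E := ⟨w, 0, hw0⟩
  have hsum : inner ℝ (star ρ p w) w + inner ℝ (star ρ q w) w ≤ Fintype.card α := by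
    rw [real_inner_comm, real_inner_comm w, star_apply, star_apply, inner_sum, inner_sum,
      ← Finset.sum_add_distrib]
    refine (Finset.sum_le_sum fun i _ => h.inner_swap_add_inner_swap_le hw hpq i).trans ?_
    simp
  obtain ⟨r, hr⟩ : ∃ r, inner ℝ (star ρ r w) w ≤ (Fintype.card α / 2 : ℝ) := by
    by_contra! hc
    linarith [hc p, hc q]
  have hev := (h.star_isSymmetric r).hasEigenvalue_iInf_of_finiteDimensional
  obtain ⟨v, hv⟩ := hev.exists_hasEigenvector
  refine ⟨r, ‖v‖⁻¹ • v,
    (⨅ x : {x : E // x ≠ 0}, RCLike.re (inner ℝ (star ρ r x) (x : E)) / ‖(x : E)‖ ^ 2 : ℝ),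
    norm_smul_inv_norm hv.2, ?_, ?_⟩
  · rw [map_smul, hv.apply_eq_smul, smul_comm]
    rfl
  · refine (ciInf_le ?_ (⟨w, hw0⟩ : {x : E // x ≠ 0})).trans ?_
    · refine ⟨-Fintype.card α, ?_⟩
      rintro _ ⟨⟨x, hx⟩, rfl⟩
      have hx' : 0 < ‖x‖ ^ 2 := by positivity
      simp only [RCLike.re_to_real]
      rw [le_div_iff₀ hx']
      have h1 := neg_le_of_abs_le (abs_real_inner_le_norm (star ρ r x) x)
      have h2 := mul_le_mul_of_nonneg_right (h.norm_star_le r x) (norm_nonneg x)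
      nlinarith
    · simpa [hw] using hr

variable [Nontrivial E]

lemma sum_sum_one_sub_inner_swap_le (h : IsFactorRep ρ φ) {p q : α} (hpq : p ≠ q) {v : E}
    (hv : ‖v‖ = 1) :
    ∑ j, ∑ i, (1 - inner ℝ v (ρ (swap i j) v)) ≤
      (Fintype.card α : ℝ) ^ 2 * (1 - φ (swap p q)) := by
  have hx (x : Perm α) : ∑ j, ∑ i, (1 - inner ℝ v (ρ (swap i j) v)) =
      ∑ j, ∑ i, (1 - inner ℝ v (ρ (x * swap i j * x⁻¹) v)) := by
    simp_rw [← Equiv.swap_apply_apply]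
    rw [← Equiv.sum_comp x]
    refine Finset.sum_congr rfl fun j _ => ?_
    rw [← Equiv.sum_comp x]
  have hφ : ∑ j, ∑ i, (1 - inner ℝ v (ρ (swap i j) v)) =
      ∑ j : α, ∑ i : α, (1 - φ (swap i j)) := by
    rw [← Fintype.expect_const (ι := Perm α) (∑ j, ∑ i, (1 - inner ℝ v (ρ (swap i j) v))),
      Finset.expect_congr rfl fun x _ => hx x]
    simp_rw [Finset.expect_sum_comm, Finset.expect_sub_distrib, ← h.eq_expect _ hv,
      Fintype.expect_const]
  have h1 : 0 ≤ 1 - φ (swap p q) := sub_nonneg.2 (abs_le.1 (h.abs_le_one _)).2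
  rw [hφ]
  calc ∑ j : α, ∑ i : α, (1 - φ (swap i j)) ≤ ∑ j : α, ∑ i : α, (1 - φ (swap p q)) := by
        refine Finset.sum_le_sum fun j _ => Finset.sum_le_sum fun i _ => ?_
        by_cases hij : i = j
        · rw [hij, Equiv.swap_self, ← Equiv.Perm.one_def, h.apply_one]
          linarith
        · rw [h.eq_of_cycleType (k := swap p q)]
          rw [Equiv.Perm.isSwap_iff_cycleType.1 (Equiv.Perm.swap_isSwap_iff.2 hpq),
            Equiv.Perm.isSwap_iff_cycleType.1 (Equiv.Perm.swap_isSwap_iff.2 hij)]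
    _ = _ := by simp; ring

lemma sum_norm_sub_star_le (h : IsFactorRep ρ φ) {p q : α} (hpq : p ≠ q) {v : E}
    (hv : ‖v‖ = 1) {δ : ℝ} (hδ : 0 ≤ δ) (hδφ : 2 * (1 - φ (swap p q)) ≤ δ ^ 2) :
    ∑ j, ‖(Fintype.card α : ℝ) • v - star ρ j v‖ ≤ (Fintype.card α : ℝ) ^ 2 * δ := by
  have hj (j : α) : ‖(Fintype.card α : ℝ) • v - star ρ j v‖ ^ 2 ≤
      Fintype.card α * ∑ i, 2 * (1 - inner ℝ v (ρ (swap i j) v)) := by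
    have e : (Fintype.card α : ℝ) • v - star ρ j v = ∑ i, (v - ρ (swap i j) v) := by
      simp [star_apply, Nat.cast_smul_eq_nsmul]
    rw [e]
    refine (pow_le_pow_left₀ (norm_nonneg _) (norm_sum_le _ _) 2).trans ?_
    refine (sq_sum_le_card_mul_sum_sq).trans (le_of_eq ?_)
    simp_rw [h.norm_sub_map_sq _ hv, Finset.card_univ]
  refine (sq_le_sq₀ (Finset.sum_nonneg fun _ _ => norm_nonneg _) (by positivity)).1 ?_
  calc (∑ j, ‖(Fintype.card α : ℝ) • v - star ρ j v‖) ^ 2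
      ≤ Fintype.card α * ∑ j, ‖(Fintype.card α : ℝ) • v - star ρ j v‖ ^ 2 := by
        simpa using sq_sum_le_card_mul_sum_sq (s := Finset.univ)
          (f := fun j => ‖(Fintype.card α : ℝ) • v - star ρ j v‖)
    _ ≤ Fintype.card α * ∑ j, Fintype.card α * ∑ i, 2 * (1 - inner ℝ v (ρ (swap i j) v)) := by
        gcongr with j
        exact hj j
    _ = (Fintype.card α : ℝ) ^ 2 * 2 * ∑ j, ∑ i, (1 - inner ℝ v (ρ (swap i j) v)) := by
        simp_rw [← Finset.mul_sum]
        ring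
    _ ≤ (Fintype.card α : ℝ) ^ 2 * 2 * ((Fintype.card α : ℝ) ^ 2 * (1 - φ (swap p q))) := by
        gcongr
        exact h.sum_sum_one_sub_inner_swap_le hpq hv
    _ ≤ ((Fintype.card α : ℝ) ^ 2 * δ) ^ 2 := by
        have : (0 : ℝ) ≤ (Fintype.card α : ℝ) ^ 4 := by positivity
        nlinarith

omit [Nontrivial E] in
lemma mul_abs_inner_map_le (h : IsFactorRep ρ φ) {p : α} {v : E} {c : ℝ} (hv : ‖v‖ = 1)
    (hvc : star ρ p v = c • v) (hc : c ≤ Fintype.card α / 2) (τ : Perm α) :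
    Fintype.card α / 2 * |inner ℝ v (ρ τ v)| ≤
      ‖(Fintype.card α : ℝ) • v - star ρ (τ p) v‖ := by
  have h1 : inner ℝ ((Fintype.card α : ℝ) • v - star ρ (τ p) v) (ρ τ v) =
      (Fintype.card α - c) * inner ℝ v (ρ τ v) := by
    rw [inner_sub_left, h.star_isSymmetric, star_map, hvc, map_smul, real_inner_smul_left,
      real_inner_smul_right]
    ring
  have h2 := abs_real_inner_le_norm ((Fintype.card α : ℝ) • v - star ρ (τ p) v) (ρ τ v)
  rw [h.norm_map, hv, mul_one, h1, abs_mul] at h2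
  refine le_trans ?_ h2
  gcongr
  refine le_trans ?_ (le_abs_self _)
  linarith

lemma abs_le_of_swap_near_one [FiniteDimensional ℝ E] (h : IsFactorRep ρ φ)
    (hρ : ∃ g v, ρ g v ≠ v) {p q : α} (hpq : p ≠ q) {δ : ℝ} (hδ : 0 ≤ δ)
    (hδφ : 2 * (1 - φ (swap p q)) ≤ δ ^ 2) (σ : Perm α) :
    |φ σ| ≤ 1 - σ.support.card / Fintype.card α * (1 - 4 * δ) := by
  obtain ⟨r, v, c, hv, hvc, hc⟩ := h.exists_star_eigenvector hρ
  have hn : 2 ≤ Fintype.card α := Fintype.one_lt_card_iff.2 ⟨p, q, hpq⟩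
  have hn' : (2 : ℝ) ≤ Fintype.card α := by exact_mod_cast hn
  set N : ℝ := (Fintype.card α : ℝ) with hN
  let B (j : α) : ℝ := if j = r then 1 else 2 / N * ‖N • v - star ρ j v‖
  have hB (τ : Perm α) : |inner ℝ v (ρ τ v)| ≤ B (τ r) := by
    simp only [B]
    split_ifs with hτ
    · exact h.abs_inner_map_le _ hv
    · have := h.mul_abs_inner_map_le hv hvc hc τ
      rw [div_mul_eq_mul_div, le_div_iff₀ (by linarith)]
      linarith
  have h1 : |φ σ| ≤ 𝔼 x : Perm α, B ((x * σ * x⁻¹) r) := by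
    rw [h.eq_expect σ hv]
    exact (Finset.abs_expect_le _ _).trans (Finset.expect_le_expect fun x _ => hB _)
  rw [expect_conj_apply_perm σ r hn B, ← hN] at h1
  have h2 : ∑ j ∈ Finset.univ.erase r, B j ≤ 2 * N * δ := by
    calc ∑ j ∈ Finset.univ.erase r, B j
        = ∑ j ∈ Finset.univ.erase r, 2 / N * ‖N • v - star ρ j v‖ :=
          Finset.sum_congr rfl fun j hj => if_neg (Finset.ne_of_mem_erase hj)
      _ ≤ ∑ j, 2 / N * ‖N • v - star ρ j v‖ :=
          Finset.sum_le_sum_of_subset_of_nonneg (Finset.erase_subset _ _)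
            fun _ _ _ => by positivity
      _ ≤ 2 / N * (N ^ 2 * δ) := by
          rw [← Finset.mul_sum]
          gcongr
          exact h.sum_norm_sub_star_le hpq hv hδ hδφ
      _ = 2 * N * δ := by field_simp
  have h3 : σ.support.card / N / (N - 1) * ∑ j ∈ Finset.univ.erase r, B j ≤
      σ.support.card / N * (4 * δ) := by
    have hN1 : 0 < N - 1 := by linarith
    rw [div_mul_eq_mul_div, mul_div_assoc]
    gcongr
    rw [div_le_iff₀ hN1]
    nlinarith
  have h4 : B r = 1 := if_pos rfl
  rw [h4] at h1
  linarith
end IsFactorRep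

namespace IsFactorRep

section SignTwist

variable {α E : Type*} [Fintype α] [DecidableEq α] [NormedAddCommGroup E]
  [InnerProductSpace ℝ E] {ρ : Perm α →* (E →ₗ[ℝ] E)} {φ : Perm α → ℝ}

/-- The representation `ρ` tensored with the sign character. -/
def signTwist (ρ : Perm α →* (E →ₗ[ℝ] E)) : Perm α →* (E →ₗ[ℝ] E) where
  toFun g := Perm.sign g • ρ g
  map_one' := by simp
  map_mul' g k := by
    rw [map_mul, map_mul, smul_mul_smul_comm]

lemma signTwist_apply (g : Perm α) (v : E) : signTwist ρ g v = Perm.sign g • ρ g v := rfl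

lemma isFactorRep_signTwist (h : IsFactorRep ρ φ) :
    IsFactorRep (signTwist ρ) fun g => Perm.sign g • φ g where
  norm_map g v := by
    rw [signTwist_apply]
    rcases Int.units_eq_one_or (Perm.sign g) with hg | hg <;> simp [hg, h.norm_map]
  expect_inner g v w := by
    rw [smul_mul_assoc, ← h.expect_inner, Finset.smul_expect]
    refine Finset.expect_congr rfl fun x _ => ?_
    rw [signTwist_apply, Perm.sign_mul, mul_comm, ← Perm.sign_mul, inv_mul_cancel_left]
    rcases Int.units_eq_one_or (Perm.sign g) with hg | hg <;> simp [hg]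

end SignTwist

lemma le_one_sub_of_abs_le {n s ε x : ℝ} (hε : 0 < ε) (hs : 0 ≤ s)
    (hn : 2 / ε + 1 ≤ n) (hx : |x| ≤ 1 - s / n * (1 - 4 * (ε / 8))) :
    (1 - ε) * (s / (n - 1)) ≤ 1 - x := by
  have h2 : 2 / ε * ε = 2 := by field_simp
  have h2' : 0 < 2 / ε := by positivity
  have hn1 : 0 < n - 1 := by linarith
  have hn0 : 0 < n := by linarith
  have h3 := le_of_abs_le hx
  have h4 : (1 - ε) / (n - 1) ≤ (1 - 4 * (ε / 8)) / n := by
    rw [div_le_div_iff₀ hn1 hn0]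
    nlinarith [mul_le_mul_of_nonneg_right hn hε.le]
  calc (1 - ε) * (s / (n - 1)) = s * ((1 - ε) / (n - 1)) := by ring
    _ ≤ s * ((1 - 4 * (ε / 8)) / n) := by gcongr
    _ = s / n * (1 - 4 * (ε / 8)) := by ring
    _ ≤ 1 - x := by linarith

lemma le_one_sub_of_sq_le {n s ε x : ℝ} (hε : 0 < ε) (hε1 : ε ≤ 1) (hs : s ≤ n)
    (hn : 2 / ε + 1 ≤ n) (hx : x ≤ ε / 2) :
    (1 - ε) * (s / (n - 1)) ≤ 1 - x := by
  have h2 : 2 / ε * ε = 2 := by field_simp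
  have h2' : 0 < 2 / ε := by positivity
  have hn1 : 0 < n - 1 := by linarith
  have hn0 : 0 < n := by linarith
  calc (1 - ε) * (s / (n - 1)) ≤ (1 - ε) * (n / (n - 1)) := by
        have : 0 ≤ 1 - ε := by linarith
        gcongr
    _ ≤ 1 - ε / 2 := by
        rw [mul_div_assoc', div_le_iff₀ hn1]
        nlinarith [mul_le_mul_of_nonneg_right hn hε.le]
    _ ≤ 1 - x := by linarith

theorem exists_forall_mul_le_one_sub {ε : ℝ} (hε : 0 < ε) (hε1 : ε ≤ 1) :
    ∃ N : ℕ, ∀ n ≥ N, ∀ (E : Type) [NormedAddCommGroup E] [InnerProductSpace ℝ E]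
      [FiniteDimensional ℝ E] [Nontrivial E] (ρ : Perm (Fin n) →* (E →ₗ[ℝ] E))
      (φ : Perm (Fin n) → ℝ), IsFactorRep ρ φ → (∃ g v, ρ g v ≠ v) →
      (∃ g v, ρ g v ≠ Perm.sign g • v) → ∀ σ,
      (1 - ε) * (σ.support.card / ((n : ℝ) - 1)) ≤ 1 - φ σ := by
  set η : ℝ := (ε / 8) ^ 2 / 2 with hη
  have hη0 : 0 < η := by positivity
  set a : ℝ := (η / 2 * (ε / 2)) ^ 2 with ha
  have ha0 : 0 < a := by positivity
  obtain ⟨m, hm⟩ := exists_nat_ge (4 / a)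
  have hm0 : 0 < m := by
    have : (0 : ℝ) < m := lt_of_lt_of_le (by positivity) hm
    exact_mod_cast this
  have hma : 2 / (m : ℝ) ≤ a / 2 := by
    have : (0 : ℝ) < m := by exact_mod_cast hm0
    rw [div_le_iff₀ ha0] at hm
    rw [div_le_iff₀ this]
    linarith
  obtain ⟨N, hN⟩ := exists_nat_ge
    (4 + (2 / ε + 1) + 16 / η + 64 / a + (6 * m + 2) + (1 + 6 * m * 32 / η))
  refine ⟨N, fun n hn E _ _ _ _ ρ φ h hρ hρ' σ => ?_⟩
  have hnN : (N : ℝ) ≤ n := by exact_mod_cast hn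
  have p1 : 0 < 2 / ε := by positivity
  have p2 : 0 < 16 / η := by positivity
  have p3 : 0 < 64 / a := by positivity
  have p4 : 0 < 6 * m * 32 / η := by positivity
  have p5 : (0 : ℝ) < m := by exact_mod_cast hm0
  have h4 : 4 ≤ n := by
    have : (4 : ℝ) ≤ n := by linarith
    exact_mod_cast this
  have hnε : 2 / ε + 1 ≤ n := by linarith
  have hn0 : (0 : ℝ) < n := by linarith
  have hn1 : (0 : ℝ) < n - 1 := by linarith
  have hsn : (σ.support.card : ℝ) ≤ n := by
    exact_mod_cast (Finset.card_le_univ _).trans_eq (Fintype.card_fin n)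
  have hcard : (Fintype.card (Fin n) : ℝ) = n := by simp
  let f : Fin 4 ↪ Fin n := Fin.castLEEmb h4
  have hf (i j : Fin 4) (hij : i ≠ j) : f i ≠ f j := f.injective.ne hij
  have h01 := hf 0 1 (by decide)
  obtain ⟨d, hd⟩ : ∃ d : Perm (Fin n), d.cycleType = {2, 2} := by
    refine ⟨swap (f 0) (f 1) * swap (f 2) (f 3), Perm.cycleType_swap_mul_swap_of_nodup ?_⟩
    simp [f.injective.eq_iff]
  set t := φ (swap (f 0) (f 1)) with ht
  rcases lt_or_ge (1 - η) |t| with htη | htη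
  · refine le_one_sub_of_abs_le hε (by positivity) hnε ?_
    rcases lt_abs.1 htη with h' | h'
    · rw [← hcard]
      refine h.abs_le_of_swap_near_one hρ h01 (by positivity) ?_ σ
      linarith
    · have key := h.isFactorRep_signTwist.abs_le_of_swap_near_one (δ := ε / 8) ?_ h01
        (by positivity) ?_ σ
      · rw [hcard] at key
        refine le_trans (le_of_eq ?_) key
        rcases Int.units_eq_one_or (Perm.sign σ) with hg | hg <;> simp [hg]
      · obtain ⟨g, v, hgv⟩ := hρ'
        refine ⟨g, v, fun hc => hgv ?_⟩
        rw [signTwist_apply] at hc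
        conv_rhs => rw [← hc]
        rw [smul_smul, Int.units_mul_self, one_smul]
      · rw [Perm.sign_swap h01]
        simp only [Units.neg_smul, one_smul]
        linarith
  · have ht2 : t ^ 2 ≤ 1 - η := by
      have := abs_nonneg t
      rw [← sq_abs]
      nlinarith
    have hdη : η / 2 ≤ 1 - φ d := by
      have h1 := h.le_swap_sq_add hd h01
      have h2 : 8 / (n : ℝ) ≤ η / 2 := by
        have : 16 / η ≤ n := by linarith
        rw [div_le_iff₀ hη0] at this
        rw [div_le_iff₀ hn0]
        linarith
      rw [hcard] at h1
      linarith
    rcases le_or_gt (6 * m) σ.support.card with hs | hs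
    · have h1 := h.sq_le_of_le_card_support hm0 hs hd
      have h2 : 32 / (n : ℝ) ≤ a / 2 := by
        have : 64 / a ≤ n := by linarith
        rw [div_le_iff₀ ha0] at this
        rw [div_le_iff₀ hn0]
        linarith
      rw [hcard] at h1
      have h3 : ((1 - φ d) * φ σ) ^ 2 ≤ (η / 2 * (ε / 2)) ^ 2 := by linarith
      refine le_one_sub_of_sq_le hε hε1 hsn hnε ?_
      by_contra! hc
      have h5 := abs_le_of_sq_le_sq h3 (by positivity)
      have h6 : η / 2 * (ε / 2) < (1 - φ d) * φ σ := by
        have : 0 < η / 2 := by positivity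
        nlinarith
      linarith [le_of_abs_le h5]
    · rcases eq_or_ne σ 1 with rfl | hσ
      · simp [h.apply_one]
      · have hs' : (σ.support.card : ℝ) ≤ 6 * m := by exact_mod_cast hs.le
        have hfix : σ.support.card + 2 ≤ Fintype.card (Fin n) := by
          have : (σ.support.card : ℝ) + 2 ≤ n := by linarith
          rw [Fintype.card_fin]
          exact_mod_cast this
        have h1 := h.one_sub_le_of_fixed hd hσ hfix
        have h2 : (σ.support.card : ℝ) / (n - 1) ≤ η / 32 := by
          have : 6 * m * 32 / η ≤ n - 1 := by linarith
          rw [div_le_iff₀ hη0] at this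
          rw [div_le_iff₀ hn1]
          linarith
        have h3 : (0 : ℝ) ≤ σ.support.card / (n - 1) := by positivity
        nlinarith

end IsFactorRep

section Bridge

lemma exists_linearEquiv_norm_map_eq {G W : Type} [Group G] [Fintype G] [AddCommGroup W]
    [Module ℝ W] [FiniteDimensional ℝ W] (ρ : G →* (W →ₗ[ℝ] W)) :
    ∃ (E : Type) (_ : NormedAddCommGroup E) (_ : InnerProductSpace ℝ E) (e : W ≃ₗ[ℝ] E),
      ∀ g w, ‖e (ρ g w)‖ = ‖e w‖ := by
  let b : W ≃ₗ[ℝ] EuclideanSpace ℝ (Fin (Module.finrank ℝ W)) :=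
    LinearEquiv.ofFinrankEq _ _ (by simp)
  let F : W →ₗ[ℝ] PiLp 2 fun _ : G => EuclideanSpace ℝ (Fin (Module.finrank ℝ W)) :=
    (WithLp.linearEquiv 2 ℝ _).symm.toLinearMap ∘ₗ LinearMap.pi fun g => b.toLinearMap ∘ₗ ρ g
  have hF (w : W) : ‖F w‖ ^ 2 = ∑ g, ‖b (ρ g w)‖ ^ 2 := by
    rw [PiLp.norm_sq_eq_of_L2]
    rfl
  have hinj : Function.Injective F := by
    intro v w hvw
    have := congrArg (fun f => f 1) hvw
    simpa [F] using this
  refine ⟨LinearMap.range F, inferInstance, inferInstance, LinearEquiv.ofInjective F hinj,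
    fun g w => ?_⟩
  rw [← sq_eq_sq₀ (norm_nonneg _) (norm_nonneg _)]
  change ‖F (ρ g w)‖ ^ 2 = ‖F w‖ ^ 2
  rw [hF, hF]
  refine Fintype.sum_equiv (Equiv.mulRight g) _ _ fun k => ?_
  rw [Equiv.coe_mulRight, map_mul]
  rfl

lemma exists_isFactorRep {α V : Type} [Fintype α] [DecidableEq α] [AddCommGroup V] [Module ℂ V]
    [FiniteDimensional ℂ V] [Nontrivial V] (π : Perm α →* (V →ₗ[ℂ] V))
    (hπ : ∀ A : V →ₗ[ℂ] V, (∀ g, A * π g = π g * A) → ∃ z : ℂ, A = z • 1) :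
    ∃ (E : Type) (_ : NormedAddCommGroup E) (_ : InnerProductSpace ℝ E) (e : V ≃ₗ[ℝ] E)
      (ρ : Perm α →* (E →ₗ[ℝ] E)), (∀ g v, ρ g (e v) = e (π g v)) ∧
      IsFactorRep ρ fun g =>
        (LinearMap.trace ℂ V (π g) / LinearMap.trace ℂ V (π 1)).re := by
  have : FiniteDimensional ℝ V := FiniteDimensional.trans ℝ ℂ V
  let πR : Perm α →* (V →ₗ[ℝ] V) :=
    { toFun g := (π g).restrictScalars ℝ
      map_one' := by rw [map_one]; rfl
      map_mul' g k := by rw [map_mul]; rfl }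
  obtain ⟨E, _, _, e, he⟩ := exists_linearEquiv_norm_map_eq πR
  have : FiniteDimensional ℝ E := e.finiteDimensional
  have : Nontrivial E := e.injective.nontrivial
  let ρ : Perm α →* (E →ₗ[ℝ] E) :=
    { toFun g := e.conj (πR g)
      map_one' := by rw [map_one]; exact e.conj_id
      map_mul' g k := by rw [map_mul]; exact e.conj_comp _ _ }
  have hρ (g : Perm α) (v : V) : ρ g (e v) = e (π g v) := by
    change e (πR g (e.symm (e v))) = _
    rw [e.symm_apply_apply]
    rfl
  have hnorm (g : Perm α) (v : E) : ‖ρ g v‖ = ‖v‖ := by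
    obtain ⟨v, rfl⟩ := e.surjective v
    rw [hρ]
    exact he g v
  have hinv (g : Perm α) (v w : E) : inner ℝ (ρ g v) w = inner ℝ v (ρ g⁻¹ w) := by
    rw [← LinearIsometry.inner_map_map (⟨ρ g, hnorm g⟩ : E →ₗᵢ[ℝ] E) v,
      LinearIsometry.coe_mk, ← Module.End.mul_apply, ← map_mul, mul_inv_cancel, map_one]
    rfl
  refine ⟨E, _, _, e, ρ, hρ, hnorm, fun g v w => ?_⟩
  obtain ⟨z, hz⟩ := hπ (∑ x, π (x * g * x⁻¹)) fun k => by
    rw [Finset.sum_mul, Finset.mul_sum]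
    refine (Fintype.sum_equiv (Equiv.mulLeft k) _ _ fun x => ?_).symm
    rw [← map_mul, ← map_mul]
    simp [mul_assoc]
  have hzE (v : V) : ∑ x, ρ (x * g * x⁻¹) (e v) = e (z • v) := by
    simp_rw [hρ]
    rw [← map_sum, ← LinearMap.sum_apply, hz]
    rfl
  have hsymm : (∑ x, ρ (x * g * x⁻¹)).IsSymmetric := by
    obtain ⟨c, hc⟩ := isConj_iff.1 (Perm.isConj_iff_cycleType_eq.2 (Perm.cycleType_inv g).symm)
    intro v w
    rw [LinearMap.sum_apply, LinearMap.sum_apply, sum_inner, inner_sum]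
    refine (Fintype.sum_equiv (Equiv.mulRight c⁻¹) _ _ fun x => ?_).symm
    rw [hinv]
    simp [mul_assoc, ← hc]
  obtain ⟨u, hu⟩ := hsymm.hasEigenvalue_iInf_of_finiteDimensional.exists_hasEigenvector
  set μ : ℝ := ⨅ x : {x : E // x ≠ 0},
    RCLike.re (inner ℝ ((∑ x, ρ (x * g * x⁻¹)) x) (x : E)) / ‖(x : E)‖ ^ 2
  have hzμ : z = μ := by
    obtain ⟨v, rfl⟩ := e.surjective u
    have h1 := hu.apply_eq_smul
    rw [LinearMap.sum_apply, hzE] at h1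
    have h2 : z • v = (μ : ℂ) • v := by
      rw [Complex.coe_smul]
      exact e.injective (h1.trans (e.map_smul μ v).symm)
    have hv : v ≠ 0 := by
      rintro rfl
      exact hu.2 (map_zero e)
    exact smul_left_injective ℂ hv h2
  have htr : (Fintype.card (Perm α) : ℂ) * LinearMap.trace ℂ V (π g) =
      μ * LinearMap.trace ℂ V (π 1) := by
    have := congrArg (LinearMap.trace ℂ V) hz
    rw [map_sum, map_smul, ← map_one π, hzμ, smul_eq_mul] at this
    rw [← this, Finset.sum_congr rfl (g := fun _ => LinearMap.trace ℂ V (π g))]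
    · simp
    · intro x _
      rw [map_mul, LinearMap.trace_mul_comm, ← map_mul]
      simp
  have htr1 : LinearMap.trace ℂ V (π 1) ≠ 0 := by
    rw [map_one, LinearMap.trace_one]
    exact_mod_cast Module.finrank_pos.ne'
  have hc : (Fintype.card (Perm α) : ℂ) ≠ 0 := by exact_mod_cast Fintype.card_ne_zero
  have hquot : LinearMap.trace ℂ V (π g) / LinearMap.trace ℂ V (π 1) =
      ((μ / Fintype.card (Perm α) : ℝ) : ℂ) := by
    push_cast
    rw [div_eq_div_iff htr1 hc]
    linear_combination htr
  obtain ⟨w, rfl⟩ := e.surjective w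
  rw [hquot, Complex.ofReal_re, Fintype.expect_eq_sum_div_card, ← inner_sum, hzE, hzμ,
    Complex.coe_smul, e.map_smul, real_inner_smul_right]
  ring

lemma FDRep.exists_eq_smul_one {G : Type} [Group G] (V : FDRep ℂ G) [Simple V]
    (A : V →ₗ[ℂ] V) (hA : ∀ g, A * V.ρ g = V.ρ g * A) : ∃ z : ℂ, A = z • 1 := by
  let f : V ⟶ V := ⟨InducedCategory.homMk (ModuleCat.ofHom A), fun g => by
    ext v
    exact LinearMap.congr_fun (hA g) v⟩
  obtain ⟨z, hz⟩ := endomorphism_simple_eq_smul_id ℂ f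
  refine ⟨z, ?_⟩
  have := congrArg (fun k : V ⟶ V => k.hom.hom.hom) hz
  exact this.symm

lemma FDRep.character_eq_of_forall_eq_smul {G : Type} [Group G] [Fintype G] (V : FDRep ℂ G)
    [Simple V] (c : G →* ℤˣ) (hc : ∀ g (v : V), V.ρ g v = c g • v) :
    V.character = fun g => ((c g : ℤ) : ℂ) := by
  have hχ (g : G) : V.character g = (c g : ℤ) * Module.finrank ℂ V := by
    have : V.ρ g = ((c g : ℤ) : ℂ) • 1 := by
      ext v
      rw [hc]
      rcases Int.units_eq_one_or (c g) with h | h <;> simp [h]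
    rw [FDRep.character, this, map_smul, LinearMap.trace_one, smul_eq_mul]
  have hcard : (Nat.card G : ℂ) ≠ 0 := by exact_mod_cast Nat.card_pos.ne'
  let _ : Invertible (Nat.card G : ℂ) := invertibleOfNonzero hcard
  have h1 := FDRep.char_orthonormal V V
  have h2 (g : G) : V.character g * V.character g⁻¹ = (Module.finrank ℂ V : ℂ) ^ 2 := by
    rw [hχ, hχ, map_inv]
    rcases Int.units_eq_one_or (c g) with h | h <;> simp [h, sq]
  rw [if_pos ⟨Iso.refl V⟩] at h1
  simp_rw [h2] at h1
  rw [Finset.sum_const, Finset.card_univ, ← Nat.card_eq_fintype_card, nsmul_eq_mul,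
    inv_mul_cancel_left₀ hcard] at h1
  have h3 : Module.finrank ℂ V = 1 := by
    have : Module.finrank ℂ V ^ 2 = 1 := by exact_mod_cast h1
    simpa using this
  funext g
  rw [hχ, h3]
  simp

lemma FDRep.nontrivial_of_simple {G : Type} [Group G] (V : FDRep ℂ G) [Simple V] :
    Nontrivial V := by
  by_contra hV
  rw [not_nontrivial_iff_subsingleton] at hV
  refine id_nonzero V ?_
  ext v
  exact Subsingleton.elim _ _

end Bridge

lemma fixCount_add_card_support {n : ℕ} (σ : Perm (Fin n)) :
    fixCount σ + σ.support.card = n := by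
  rw [fixCount, Perm.support, Finset.card_filter_add_card_filter_not, Finset.card_univ,
    Fintype.card_fin]

/-- **Theorem (normal sets, positive result).** For every `ε > 0` there is `N` such that for
all `n ≥ N`, every non-negative conjugation-invariant `α : S_n → ℝ` and every irreducible
character `χ ∉ {triv, sgn}` of `S_n`:
`∑ σ, α(σ)(1 - χ̃(σ)) ≥ (1 - ε) ∑ σ, α(σ)(1 - (c₁(σ)-1)/(n-1))`. -/
theorem normal_sets_spectral_gap (ε : ℝ) (hε : 0 < ε) :
    ∃ N : ℕ, ∀ n : ℕ, n ≥ N → ∀ α : Equiv.Perm (Fin n) → ℝ,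
      (∀ σ, 0 ≤ α σ) →
      (∀ σ τ : Equiv.Perm (Fin n), α (τ * σ * τ⁻¹) = α σ) →
      ∀ V : FDRep ℂ (Equiv.Perm (Fin n)), IsNontrivIrr V →
        ∑ σ : Equiv.Perm (Fin n), α σ * (1 - normChar V σ) ≥
          (1 - ε) * ∑ σ : Equiv.Perm (Fin n),
            α σ * (1 - ((fixCount σ : ℝ) - 1) / ((n : ℝ) - 1)) := by
  obtain ⟨N, hN⟩ := IsFactorRep.exists_forall_mul_le_one_sub
    (lt_min hε one_pos) (min_le_right ε 1)
  refine ⟨max N 2, fun n hn α hα _ V hV => ?_⟩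
  obtain ⟨hsimple, htriv, hsign⟩ := hV
  have := V.nontrivial_of_simple
  obtain ⟨E, _, _, e, ρ, hρ, hφ⟩ := exists_isFactorRep V.ρ V.exists_eq_smul_one
  have : FiniteDimensional ℝ V := FiniteDimensional.trans ℝ ℂ V
  have : FiniteDimensional ℝ E := e.finiteDimensional
  have : Nontrivial E := e.injective.nontrivial
  have hntriv (c : Perm (Fin n) →* ℤˣ) (hc : V.character ≠ fun g => ((c g : ℤ) : ℂ)) :
      ∃ g v, ρ g v ≠ c g • v := by
    by_contra! h
    refine hc (V.character_eq_of_forall_eq_smul c fun g v => e.injective ?_)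
    rw [← hρ, h]
    rcases Int.units_eq_one_or (c g) with h | h <;> simp [h]
  have key := hN n (le_of_max_le_left hn) E ρ _ hφ
    (by simpa using hntriv 1 (by simpa using htriv)) (hntriv Perm.sign hsign)
  have hn2 : (2 : ℝ) ≤ n := by exact_mod_cast le_of_max_le_right hn
  rw [ge_iff_le, Finset.mul_sum]
  refine Finset.sum_le_sum fun σ _ => ?_
  have hfix : (fixCount σ : ℝ) + σ.support.card = n := by
    exact_mod_cast fixCount_add_card_support σ
  have hs : 1 - ((fixCount σ : ℝ) - 1) / (n - 1) = σ.support.card / (n - 1) := by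
    have : (n : ℝ) - 1 ≠ 0 := by linarith
    field_simp
    linarith
  rw [mul_left_comm, hs]
  refine mul_le_mul_of_nonneg_left (le_trans ?_ (key σ)) (hα σ)
  have hn1 : (0 : ℝ) < n - 1 := by linarith
  gcongr
  exact min_le_left _ _
end

section
/- (Aldous' spectral gap conjecture, weighted form.) Let n ≥ 2 and let α : S_n → ℝ be a non-negative function supported on transpositions. Let A be the |S_n| × |S_n| real symmetric matrix with A_{g,h} = α(g h⁻¹), and let B be the n × n real symmetric matrix with B_{i,j} = α((i j)) for i ≠ j and B_{i,i} = Σ_{τ transposition, τ(i)=i} α(τ). Then the supremum of the Rayleigh quotient ⟨A f, f⟩/⟨f, f⟩ over all nonzero f : S_n → ℝ with Σ_{g ∈ S_n} f(g) = 0 equals the supremum of ⟨B u, u⟩/⟨u, u⟩ over all nonzero u ∈ ℝⁿ with Σ_i u_i = 0. (That is, the second eigenvalue of the weighted Cayley graph Cay(S_n, Σ) equals the largest eigenvalue of the standard representation, which is the second eigenvalue of the weighted Schreier graph of the action of S_n on {1,...,n}.) -/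
open scoped Classical

/-- The adjacency matrix of the weighted Schreier graph of the action of `S_n` on
`{1,…,n}`: `B i j = α((i j))` for `i ≠ j`, and `B i i = ∑_{τ transposition, τ i = i} α(τ)`. -/

noncomputable def schreierMatrix (n : ℕ) (α : Equiv.Perm (Fin n) → ℝ) (i j : Fin n) : ℝ :=
  if i = j then
    ∑ τ ∈ Finset.univ.filter (fun τ : Equiv.Perm (Fin n) => τ.IsSwap ∧ τ i = i), α τ
  else α (Equiv.swap i j)

section OctopusForms

variable {V R : Type*} [DecidableEq V] [CommRing R]

/-- The second difference of `φ` on transpositions, based at the vertex `o`. -/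
def octE (φ : Equiv.Perm V → R) (o i j : V) : R :=
  φ 1 + φ (Equiv.swap i j) - φ (Equiv.swap o i) - φ (Equiv.swap o j)

/-- The fourth difference of `φ` on products of two transpositions, based at `o`. -/
def octN (φ : Equiv.Perm V → R) (o i j k l : V) : R :=
  octE (fun σ => octE (fun τ => φ (σ * τ)) o k l) o i j

/-- The second difference of the Kronecker delta, based at `o`. -/
def octD (R : Type*) [CommRing R] (o i j : V) : R :=
  (if i = j then 1 else 0) - (if i = o then 1 else 0) - (if j = o then 1 else 0) + 1

/-- The summand of the octopus form attached to the pairing `ij | kl`. -/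
def octP (φ : Equiv.Perm V → R) (o i j k l : V) : R :=
  octD R o i j * octE φ o k l + octD R o k l * octE φ o i j - octN φ o i j k l

/-- The sum of `octP` over the three pairings of four vertices. -/
def octH (φ : Equiv.Perm V → R) (o i j k l : V) : R :=
  octP φ o i j k l + octP φ o i k j l + octP φ o i l j k

lemma octE_comm (φ : Equiv.Perm V → R) (o i j : V) : octE φ o i j = octE φ o j i := by
  simp only [octE, Equiv.swap_comm i j]; ring

lemma octD_comm (o i j : V) : octD R o i j = octD R o j i := by
  simp only [octD, eq_comm (a := i) (b := j)]; ring

lemma octN_comm_left (φ : Equiv.Perm V → R) (o i j k l : V) :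
    octN φ o i j k l = octN φ o j i k l := octE_comm _ _ _ _

lemma octN_comm_right (φ : Equiv.Perm V → R) (o i j k l : V) :
    octN φ o i j k l = octN φ o i j l k := by
  simp only [octN, octE_comm _ o k l]

lemma octN_comm (φ : Equiv.Perm V → R) (hφ : ∀ σ, φ σ⁻¹ = φ σ) (o i j k l : V) :
    octN φ o i j k l = octN φ o k l i j := by
  have h : ∀ a b c d : V, φ (Equiv.swap a b * Equiv.swap c d) =
      φ (Equiv.swap c d * Equiv.swap a b) := fun a b c d => by
    rw [← hφ, mul_inv_rev, Equiv.swap_inv, Equiv.swap_inv]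
  simp only [octN, octE, one_mul, mul_one]
  rw [h k l i j, h k l o i, h k l o j, h o k i j, h o k o i, h o k o j, h o l i j, h o l o i,
    h o l o j]
  ring

lemma octP_comm_left (φ : Equiv.Perm V → R) (o i j k l : V) :
    octP φ o i j k l = octP φ o j i k l := by
  simp only [octP, octD_comm o i j, octE_comm φ o i j, octN_comm_left φ o i j]

lemma octP_comm_right (φ : Equiv.Perm V → R) (o i j k l : V) :
    octP φ o i j k l = octP φ o i j l k := by
  simp only [octP, octD_comm o k l, octE_comm φ o k l, octN_comm_right φ o i j k l]

lemma octP_comm (φ : Equiv.Perm V → R) (hφ : ∀ σ, φ σ⁻¹ = φ σ) (o i j k l : V) :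
    octP φ o i j k l = octP φ o k l i j := by
  simp only [octP, octN_comm φ hφ o i j k l]; ring

lemma octH_swap_first (φ : Equiv.Perm V → R) (hφ : ∀ σ, φ σ⁻¹ = φ σ) (o i j k l : V) :
    octH φ o i j k l = octH φ o j i k l := by
  simp only [octH]
  rw [octP_comm_left φ o i j, octP_comm φ hφ o i k j l, octP_comm φ hφ o i l j k]
  rw [octP_comm_right φ o j k i l, octP_comm_right φ o j l i k, octP_comm_left φ o j k l i,
    octP_comm_left φ o j l k i]
  rw [octP_comm φ hφ o k j l i, octP_comm φ hφ o l j k i, octP_comm_left φ o l i,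
    octP_comm_left φ o k i, octP_comm_right φ o i l, octP_comm_right φ o i k,
    octP_comm φ hφ o i l j k, octP_comm φ hφ o i k j l]
  ring

lemma octH_swap_middle (φ : Equiv.Perm V → R) (o i j k l : V) :
    octH φ o i j k l = octH φ o i k j l := by
  simp only [octH]
  rw [octP_comm_right φ o i l j k]
  ring

lemma octH_swap_last (φ : Equiv.Perm V → R) (o i j k l : V) :
    octH φ o i j k l = octH φ o i j l k := by
  simp only [octH]
  rw [octP_comm_right φ o i j k l]
  ring

lemma octH_base (φ : Equiv.Perm V → R) (o j k l : V) : octH φ o o j k l = 0 := by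
  have hE : ∀ (φ : Equiv.Perm V → R) j, octE φ o o j = 0 := fun φ j => by
    simp [octE, ← Equiv.Perm.one_def]
  have hD : ∀ j, octD R o o j = 0 := fun j => by simp [octD, eq_comm (a := o)]
  simp [octH, octP, hE, hD, octN]

lemma octH_hom {W : Type*} [DecidableEq W] (e : W ↪ V) (φ : Equiv.Perm V → R)
    (h : Equiv.Perm W →* Equiv.Perm V)
    (hh : ∀ a b, h (Equiv.swap a b) = Equiv.swap (e a) (e b)) (o i j k l : W) :
    octH φ (e o) (e i) (e j) (e k) (e l) = octH (fun σ => φ (h σ)) o i j k l := by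
  simp only [octH, octP, octN, octE, octD, map_mul, map_one, hh, e.injective.eq_iff]

/-- The Kronecker delta. -/
def octDelta {G : Type*} [DecidableEq G] (σ τ : G) : ℤ := if σ = τ then 1 else 0

lemma octH_eq_sum [Fintype V] (φ : Equiv.Perm V → R) (o i j k l : V) :
    octH φ o i j k l = ∑ σ, φ σ * (octH (octDelta σ) o i j k l : ℤ) := by
  have h1 : ∀ x, φ x = ∑ σ, φ σ * (octDelta σ x : ℤ) := fun x => by simp [octDelta]
  have hE : ∀ i j, octE φ o i j = ∑ σ, φ σ * (octE (octDelta σ) o i j : ℤ) := fun i j => by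
    simp only [octE, Int.cast_add, Int.cast_sub, mul_add, mul_sub, Finset.sum_add_distrib,
      Finset.sum_sub_distrib, ← h1]
  have hN : ∀ i j k l, octN φ o i j k l = ∑ σ, φ σ * (octN (octDelta σ) o i j k l : ℤ) :=
    fun i j k l => by
      simp only [octN, octE, Int.cast_add, Int.cast_sub, mul_add, mul_sub,
        Finset.sum_add_distrib, Finset.sum_sub_distrib, ← h1]
  have hD : ∀ i j, octD R o i j = (octD ℤ o i j : ℤ) := fun i j => by simp [octD]
  have hP : ∀ i j k l, octP φ o i j k l = ∑ σ, φ σ * (octP (octDelta σ) o i j k l : ℤ) :=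
    fun i j k l => by
      simp only [octP, hE, hN, hD, Finset.mul_sum, ← Finset.sum_add_distrib,
        ← Finset.sum_sub_distrib]
      refine Finset.sum_congr rfl fun σ _ => ?_
      push_cast
      ring
  simp only [octH, hP, ← Finset.sum_add_distrib]
  refine Finset.sum_congr rfl fun σ _ => ?_
  push_cast
  ring

end OctopusForms

/-- If the coefficients of the octopus form agree, up to inversion, with an integral function that
is a positive multiple of a convolution idempotent, then the form is non-negative on symmetric
functions of positive type. -/
lemma octH_nonneg_of_idempotent {V : Type*} [DecidableEq V] [Fintype V] (ψ : Equiv.Perm V → ℝ)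
    (hinv : ∀ σ, ψ σ⁻¹ = ψ σ)
    (hpos : ∀ w : Equiv.Perm V → ℝ, 0 ≤ ∑ a, ∑ b, w a * w b * ψ (a⁻¹ * b))
    (o i j k l : V) (w : Equiv.Perm V → ℤ)
    (hw : ∀ σ, octH (octDelta σ) o i j k l + octH (octDelta σ⁻¹) o i j k l = 2 * w σ)
    (hidem : ∀ σ, ∑ a, w a * w (a * σ) = 12 * w σ) : 0 ≤ octH ψ o i j k l := by
  have h1 : octH ψ o i j k l = ∑ σ, ψ σ * (w σ : ℤ) := by
    have h2 : octH ψ o i j k l = ∑ σ, ψ σ * (octH (octDelta σ⁻¹) o i j k l : ℤ) := by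
      rw [octH_eq_sum, ← Equiv.sum_comp (Equiv.inv _)]
      simp [hinv]
    have h3 : 2 * octH ψ o i j k l = 2 * ∑ σ, ψ σ * (w σ : ℤ) := by
      rw [two_mul]
      nth_rewrite 2 [h2]
      rw [octH_eq_sum, ← Finset.sum_add_distrib, Finset.mul_sum]
      refine Finset.sum_congr rfl fun σ _ => ?_
      have := congrArg (Int.cast (R := ℝ)) (hw σ)
      push_cast at this
      linear_combination ψ σ * this
    linarith
  have h4 : ∑ a, ∑ b, (w a : ℝ) * w b * ψ (a⁻¹ * b) = 12 * ∑ σ, ψ σ * (w σ : ℤ) := by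
    have : ∀ a, ∑ b, (w a : ℝ) * w b * ψ (a⁻¹ * b) = ∑ σ, (w a : ℝ) * w (a * σ) * ψ σ := fun a => by
      rw [← Equiv.sum_comp (Equiv.mulLeft a)]
      simp
    simp_rw [this]
    rw [Finset.sum_comm, Finset.mul_sum]
    refine Finset.sum_congr rfl fun σ _ => ?_
    have := congrArg (Int.cast (R := ℝ)) (hidem σ)
    push_cast at this
    rw [← Finset.sum_mul, this]
    ring
  have := hpos fun a => w a
  rw [h4, ← h1] at this
  linarith

/-- The octopus coefficients for four vertices. -/
def octW₄ (σ : Equiv.Perm (Fin 4)) : ℤ :=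
  if σ = 1 then 2 else if σ * σ = 1 then (if ∀ x, σ x ≠ x then 2 else 0) else
  if ∀ x, σ (σ (σ x)) = x then -1 else 0

/-- The octopus coefficients for five vertices. -/
def octW₅ (σ : Equiv.Perm (Fin 5)) : ℤ :=
  let n : ℕ := (if σ 0 = 0 then 1 else 0) + (if σ 1 = 1 then 1 else 0) +
    (if σ 2 = 2 then 1 else 0) + (if σ 3 = 3 then 1 else 0) + (if σ 4 = 4 then 1 else 0)
  if n = 5 then 3 else if n = 2 then (if σ 0 = 0 then 0 else -1) else
  if n = 1 then
    (if σ 0 = 0 then (if σ (σ 1) = 1 then -1 else 0) else if σ (σ 0) = 0 then 1 else 0)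
  else 0

/-- The support of `octW₅`. -/
def octSupport₅ : List (Equiv.Perm (Fin 5)) :=
  let c (p q : Fin 5) : Equiv.Perm (Fin 5) := Equiv.swap 0 p * Equiv.swap p q
  let d (p q r s : Fin 5) : Equiv.Perm (Fin 5) := Equiv.swap p q * Equiv.swap r s
  [1, c 1 2, c 1 3, c 1 4, c 2 1, c 2 3, c 2 4, c 3 1, c 3 2, c 3 4, c 4 1, c 4 2, c 4 3,
    d 0 1 2 3, d 0 1 2 4, d 0 1 3 4, d 0 2 1 3, d 0 2 1 4, d 0 2 3 4,
    d 0 3 1 2, d 0 3 1 4, d 0 3 2 4, d 0 4 1 2, d 0 4 1 3, d 0 4 2 3,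
    d 1 2 3 4, d 1 3 2 4, d 1 4 2 3]

lemma octW₄_coeff (σ : Equiv.Perm (Fin 4)) :
    octH (octDelta σ) 0 1 1 2 3 + octH (octDelta σ⁻¹) 0 1 1 2 3 = 2 * octW₄ σ := by
  revert σ; decide +kernel

lemma octW₄_idempotent (σ : Equiv.Perm (Fin 4)) :
    ∑ a, octW₄ a * octW₄ (a * σ) = 12 * octW₄ σ := by
  revert σ; decide +kernel

lemma octW₅_coeff (σ : Equiv.Perm (Fin 5)) :
    octH (octDelta σ) 0 1 2 3 4 + octH (octDelta σ⁻¹) 0 1 2 3 4 = 2 * octW₅ σ := by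
  revert σ; decide +kernel

lemma mem_octSupport₅ (σ : Equiv.Perm (Fin 5)) (h : octW₅ σ ≠ 0) : σ ∈ octSupport₅ := by
  revert σ; decide +kernel

lemma nodup_octSupport₅ : octSupport₅.Nodup := by decide +kernel

lemma octW₅_idempotent (σ : Equiv.Perm (Fin 5)) :
    ∑ a, octW₅ a * octW₅ (a * σ) = 12 * octW₅ σ := by
  have h : ∀ σ, (octSupport₅.map fun a => octW₅ a * octW₅ (a * σ)).sum = 12 * octW₅ σ := by
    decide +kernel
  rw [← h σ, ← List.sum_toFinset _ nodup_octSupport₅]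
  symm
  refine Finset.sum_subset (Finset.subset_univ _) fun a _ ha => ?_
  by_contra hne
  exact ha (List.mem_toFinset.2 (mem_octSupport₅ a (left_ne_zero_of_mul hne)))

/-- The autocorrelation of a function on a finite group. -/
def autocorr {G : Type*} [Group G] [Fintype G] (f : G → ℝ) (σ : G) : ℝ := ∑ g, f g * f (g * σ)

section Autocorr

variable {G H : Type*} [Group G] [Fintype G] [Group H]

lemma autocorr_inv_mul (f : G → ℝ) (σ τ : G) :
    autocorr f (σ⁻¹ * τ) = ∑ g, f (g * σ) * f (g * τ) := by
  rw [autocorr, ← Equiv.sum_comp (Equiv.mulRight σ)]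
  simp [mul_assoc]

lemma autocorr_inv (f : G → ℝ) (σ : G) : autocorr f σ⁻¹ = autocorr f σ := by
  have := autocorr_inv_mul f σ 1
  simp only [mul_one] at this
  rw [this, autocorr]
  exact Finset.sum_congr rfl fun g _ => mul_comm _ _

lemma autocorr_posType [Fintype H] (f : G → ℝ) (h : H →* G) (w : H → ℝ) :
    0 ≤ ∑ a, ∑ b, w a * w b * autocorr f (h (a⁻¹ * b)) := by
  have : ∑ a, ∑ b, w a * w b * autocorr f (h (a⁻¹ * b)) = ∑ g, (∑ a, w a * f (g * h a)) ^ 2 := by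
    simp only [map_mul, map_inv, autocorr_inv_mul, sq, Finset.sum_mul_sum]
    simp only [Finset.mul_sum]
    symm
    rw [Finset.sum_comm]
    refine Finset.sum_congr rfl fun a _ => ?_
    rw [Finset.sum_comm]
    refine Finset.sum_congr rfl fun b _ => Finset.sum_congr rfl fun g _ => ?_
    ring
  rw [this]
  positivity

end Autocorr

section Octopus

variable {V : Type*} [DecidableEq V] [Fintype V]

lemma viaEmbeddingHom_swap {V W : Type*} [DecidableEq V] [DecidableEq W] (e : W ↪ V) (a b : W) :
    Equiv.Perm.viaEmbeddingHom e (Equiv.swap a b) = Equiv.swap (e a) (e b) := by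
  ext x
  rw [Equiv.Perm.viaEmbeddingHom_apply]
  by_cases hx : x ∈ Set.range e
  · obtain ⟨y, rfl⟩ := hx
    rw [Equiv.Perm.viaEmbedding_apply, Equiv.swap_apply_def, Equiv.swap_apply_def]
    simp only [e.injective.eq_iff]
    split_ifs <;> rfl
  · rw [Equiv.Perm.viaEmbedding_apply_of_notMem _ _ _ hx, Equiv.swap_apply_of_ne_of_ne]
    · rintro rfl; exact hx ⟨_, rfl⟩
    · rintro rfl; exact hx ⟨_, rfl⟩

lemma injective_vecCons {α : Type*} {n : ℕ} {x : α} {v : Fin n → α} (hx : ∀ i, v i ≠ x)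
    (hv : Function.Injective v) : Function.Injective (Matrix.vecCons x v) :=
  Fin.cons_injective_iff.2 ⟨fun ⟨i, hi⟩ => hx i hi, hv⟩

lemma octH_autocorr_diag (f : Equiv.Perm V → ℝ) (o i : V) :
    octH (autocorr f) o i i i i = 0 := by
  by_cases h : i = o
  · subst h; exact octH_base _ _ _ _ _
  simp [octH, octP, octN, octE, octD, h, ← Equiv.Perm.one_def]
  ring

lemma octH_autocorr_nonneg_of_embedding (f : Equiv.Perm V → ℝ) {W : Type*} [DecidableEq W]
    [Fintype W] (e : W ↪ V) (o i j k l : W) (w : Equiv.Perm W → ℤ)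
    (hw : ∀ σ, octH (octDelta σ) o i j k l + octH (octDelta σ⁻¹) o i j k l = 2 * w σ)
    (hidem : ∀ σ, ∑ a, w a * w (a * σ) = 12 * w σ) :
    0 ≤ octH (autocorr f) (e o) (e i) (e j) (e k) (e l) := by
  rw [octH_hom e _ (Equiv.Perm.viaEmbeddingHom e) (viaEmbeddingHom_swap e)]
  refine octH_nonneg_of_idempotent (fun σ => autocorr f (Equiv.Perm.viaEmbeddingHom e σ))
    (fun σ => ?_) (fun v => ?_) o i j k l w hw hidem
  · rw [map_inv, autocorr_inv]
  · exact autocorr_posType f (Equiv.Perm.viaEmbeddingHom e) v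

lemma octH_autocorr_nonneg_three (f : Equiv.Perm V → ℝ) {o i k : V} (hi : i ≠ o) (hk : k ≠ o)
    (hik : i ≠ k) (a b : Fin 3) : 0 ≤ octH (autocorr f) o i i (![o, i, k] a) (![o, i, k] b) := by
  have h : Function.Injective ![o, i, k] :=
      injective_vecCons (by simp [Fin.forall_fin_succ]; grind) <|
      injective_vecCons (by simp; grind) <|
      Function.injective_of_subsingleton _
  refine octH_autocorr_nonneg_of_embedding f ⟨_, h⟩ 0 1 1 a b 0 (fun σ => ?_) (by simp)
  revert σ a b; decide +kernel

lemma octH_autocorr_nonneg_of_eq (f : Equiv.Perm V → ℝ) {o i k l : V} (hi : i ≠ o) (hk : k ≠ o)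
    (hl : l ≠ o) : 0 ≤ octH (autocorr f) o i i k l := by
  by_cases hik : i = k <;> by_cases hil : i = l
  · subst hik hil; exact (octH_autocorr_diag _ _ _).ge
  · subst hik
    exact octH_autocorr_nonneg_three f hi hl hil 1 2
  · subst hil
    exact octH_autocorr_nonneg_three f hi hk hik 2 1
  by_cases hkl : k = l
  · subst hkl
    exact octH_autocorr_nonneg_three f hi hk hik 2 2
  · have h : Function.Injective ![o, i, k, l] :=
      injective_vecCons (by simp [Fin.forall_fin_succ]; grind) <|
      injective_vecCons (by simp [Fin.forall_fin_succ]; grind) <|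
      injective_vecCons (by simp; grind) <|
      Function.injective_of_subsingleton _
    exact octH_autocorr_nonneg_of_embedding f ⟨_, h⟩ 0 1 1 2 3 octW₄ octW₄_coeff octW₄_idempotent

lemma octH_autocorr_nonneg (f : Equiv.Perm V → ℝ) (o i j k l : V) :
    0 ≤ octH (autocorr f) o i j k l := by
  have s1 := octH_swap_first (autocorr f) (autocorr_inv f) o
  have s2 := octH_swap_middle (autocorr f) o
  have s3 := octH_swap_last (autocorr f) o
  by_cases hi : i = o
  · subst hi; exact (octH_base _ _ _ _ _).ge
  by_cases hj : j = o
  · subst hj; rw [s1]; exact (octH_base _ _ _ _ _).ge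
  by_cases hk : k = o
  · subst hk; rw [s2, s1]; exact (octH_base _ _ _ _ _).ge
  by_cases hl : l = o
  · subst hl; rw [s3, s2, s1]; exact (octH_base _ _ _ _ _).ge
  by_cases hij : i = j
  · subst hij; exact octH_autocorr_nonneg_of_eq f hi hk hl
  by_cases hik : i = k
  · subst hik; rw [s2]; exact octH_autocorr_nonneg_of_eq f hi hj hl
  by_cases hil : i = l
  · subst hil; rw [s3, s2]; exact octH_autocorr_nonneg_of_eq f hi hj hk
  by_cases hjk : j = k
  · subst hjk; rw [s1, s2]; exact octH_autocorr_nonneg_of_eq f hj hi hl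
  by_cases hjl : j = l
  · subst hjl; rw [s1, s3, s2]; exact octH_autocorr_nonneg_of_eq f hj hi hk
  by_cases hkl : k = l
  · subst hkl; rw [s2, s1, s3, s2]; exact octH_autocorr_nonneg_of_eq f hk hi hj
  have h : Function.Injective ![o, i, j, k, l] :=
      injective_vecCons (by simp [Fin.forall_fin_succ]; grind) <|
      injective_vecCons (by simp [Fin.forall_fin_succ]; grind) <|
      injective_vecCons (by simp [Fin.forall_fin_succ]; grind) <|
      injective_vecCons (by simp; grind) <|
      Function.injective_of_subsingleton _
  exact octH_autocorr_nonneg_of_embedding f ⟨_, h⟩ 0 1 2 3 4 octW₅ octW₅_coeff octW₅_idempotent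

lemma octN_autocorr (f : Equiv.Perm V → ℝ) (o i j k l : V) :
    octN (autocorr f) o i j k l =
      ∑ g, octE (fun σ => f (g * σ)) o i j * octE (fun σ => f (g * σ)) o k l := by
  have h : ∀ a b τ, autocorr f (Equiv.swap a b * τ) = ∑ g, f (g * Equiv.swap a b) * f (g * τ) :=
    fun a b τ => by rw [← autocorr_inv_mul, Equiv.swap_inv]
  have h1 : ∀ τ, autocorr f (1 * τ) = ∑ g, f (g * 1) * f (g * τ) :=
    fun τ => by rw [← autocorr_inv_mul, inv_one]
  simp only [octN, octE, h, h1, ← Finset.sum_add_distrib, ← Finset.sum_sub_distrib]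
  exact Finset.sum_congr rfl fun g _ => by ring

/-- The **octopus inequality** of Caputo, Liggett and Richthammer. -/
theorem octopus (f : Equiv.Perm V → ℝ) (o : V) (c : V → ℝ) (hc : ∀ i, 0 ≤ c i) :
    0 ≤ ∑ i, ∑ j, c i * c j * octE (autocorr f) o i j := by
  set A := ∑ i, ∑ j, c i * c j * octE (autocorr f) o i j with hA
  set D := ∑ i, ∑ j, c i * c j * octD ℝ o i j with hD
  set N := ∑ g, (∑ i, ∑ j, c i * c j * octE (fun σ => f (g * σ)) o i j) ^ 2 with hN
  have hN0 : 0 ≤ N := Finset.sum_nonneg fun g _ => sq_nonneg _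
  let P : V → V → V → V → ℝ := fun i j k l => c i * c j * c k * c l * octP (autocorr f) o i j k l
  have hP : ∑ i, ∑ j, ∑ k, ∑ l, P i j k l = 2 * D * A - N := by
    have e1 : D * A = ∑ i, ∑ j, ∑ k, ∑ l,
        c i * c j * c k * c l * (octD ℝ o i j * octE (autocorr f) o k l) := by
      simp only [hD, hA, Finset.sum_mul]
      refine Finset.sum_congr rfl fun i _ => Finset.sum_congr rfl fun j _ => ?_
      simp only [Finset.mul_sum]
      refine Finset.sum_congr rfl fun k _ => Finset.sum_congr rfl fun l _ => ?_
      ring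
    have e2 : A * D = ∑ i, ∑ j, ∑ k, ∑ l,
        c i * c j * c k * c l * (octD ℝ o k l * octE (autocorr f) o i j) := by
      simp only [hD, hA, Finset.sum_mul]
      refine Finset.sum_congr rfl fun i _ => Finset.sum_congr rfl fun j _ => ?_
      simp only [Finset.mul_sum]
      refine Finset.sum_congr rfl fun k _ => Finset.sum_congr rfl fun l _ => ?_
      ring
    have e3 : N = ∑ i, ∑ j, ∑ k, ∑ l,
        c i * c j * c k * c l * octN (autocorr f) o i j k l := by
      simp only [hN, sq, Finset.sum_mul]
      simp only [octN_autocorr, Finset.mul_sum]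
      rw [Finset.sum_comm]
      refine Finset.sum_congr rfl fun i _ => ?_
      rw [Finset.sum_comm]
      refine Finset.sum_congr rfl fun j _ => ?_
      rw [Finset.sum_comm]
      refine Finset.sum_congr rfl fun k _ => ?_
      rw [Finset.sum_comm]
      refine Finset.sum_congr rfl fun l _ => Finset.sum_congr rfl fun g _ => ?_
      ring
    rw [show 2 * D * A - N = D * A + A * D - N by ring, e1, e2, e3]
    simp only [← Finset.sum_add_distrib, ← Finset.sum_sub_distrib, P, octP]
    refine Finset.sum_congr rfl fun i _ => Finset.sum_congr rfl fun j _ =>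
      Finset.sum_congr rfl fun k _ => Finset.sum_congr rfl fun l _ => ?_
    ring
  have hP' : ∑ i, ∑ j, ∑ k, ∑ l, P i k j l = ∑ i, ∑ j, ∑ k, ∑ l, P i j k l :=
    Finset.sum_congr rfl fun i _ => Finset.sum_comm
  have hP'' : ∑ i, ∑ j, ∑ k, ∑ l, P i l j k = ∑ i, ∑ j, ∑ k, ∑ l, P i j k l := by
    refine Finset.sum_congr rfl fun i _ => ?_
    rw [Finset.sum_congr rfl fun j _ => Finset.sum_comm, Finset.sum_comm]
  have hH : ∑ i, ∑ j, ∑ k, ∑ l, c i * c j * c k * c l * octH (autocorr f) o i j k l =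
      3 * (2 * D * A - N) := by
    have h3 : 3 * (2 * D * A - N) = ∑ i, ∑ j, ∑ k, ∑ l, P i j k l +
        ∑ i, ∑ j, ∑ k, ∑ l, P i k j l + ∑ i, ∑ j, ∑ k, ∑ l, P i l j k := by
      rw [hP', hP'', hP]; ring
    rw [h3]
    simp only [← Finset.sum_add_distrib]
    refine Finset.sum_congr rfl fun i _ => Finset.sum_congr rfl fun j _ =>
      Finset.sum_congr rfl fun k _ => Finset.sum_congr rfl fun l _ => ?_
    simp only [P, octH]
    ring
  have hH0 : 0 ≤ ∑ i, ∑ j, ∑ k, ∑ l, c i * c j * c k * c l * octH (autocorr f) o i j k l :=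
    Finset.sum_nonneg fun i _ => Finset.sum_nonneg fun j _ => Finset.sum_nonneg fun k _ =>
      Finset.sum_nonneg fun l _ => mul_nonneg
        (mul_nonneg (mul_nonneg (mul_nonneg (hc i) (hc j)) (hc k)) (hc l))
        (octH_autocorr_nonneg f o i j k l)
  have hDA : 0 ≤ D * A := by linarith
  have hD0 : ∀ i j, 0 ≤ octD ℝ o i j := fun i j => by
    simp only [octD]; split_ifs <;> norm_num
    grind
  have hterm : ∀ i j, 0 ≤ c i * c j * octD ℝ o i j := fun i j =>
    mul_nonneg (mul_nonneg (hc i) (hc j)) (hD0 i j)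
  rcases (Finset.sum_nonneg fun i _ => Finset.sum_nonneg fun j _ => hterm i j :
    0 ≤ D).eq_or_lt with h | h
  · have hc0 : ∀ i, i ≠ o → c i = 0 := fun i hi => by
      have h1 := (Finset.sum_eq_zero_iff_of_nonneg fun i _ =>
        Finset.sum_nonneg fun j _ => hterm i j).1 h.symm i (Finset.mem_univ _)
      have h2 := (Finset.sum_eq_zero_iff_of_nonneg fun j _ => hterm i j).1 h1 i (Finset.mem_univ _)
      simpa [octD, hi] using h2
    refine (Finset.sum_eq_zero fun i _ => Finset.sum_eq_zero fun j _ => ?_).ge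
    by_cases hi : i = o
    · subst hi; simp [octE, ← Equiv.Perm.one_def]
    · simp [hc0 i hi]
  · exact (mul_nonneg_iff_of_pos_left h).1 hDA

end Octopus

section Spectral

/-- To bound the quadratic form of a symmetric operator that preserves the mean-zero functions from
below on that space, it suffices to bound its eigenvalues there. -/
lemma le_quadForm_of_eigenvalues {X : Type*} [Fintype X] (L : (X → ℝ) →ₗ[ℝ] (X → ℝ))
    (hsymm : ∀ f g, ∑ x, L f x * g x = ∑ x, f x * L g x) (hL : ∀ f, ∑ x, L f x = 0) (lam : ℝ)
    (hlam : ∀ (f : X → ℝ) (μ : ℝ), f ≠ 0 → ∑ x, f x = 0 → L f = μ • f → lam ≤ μ)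
    (f : X → ℝ) (hf : ∑ x, f x = 0) : lam * ∑ x, f x ^ 2 ≤ ∑ x, f x * L f x := by
  let e : EuclideanSpace ℝ X ≃ₗ[ℝ] (X → ℝ) := WithLp.linearEquiv 2 ℝ (X → ℝ)
  let T : EuclideanSpace ℝ X →ₗ[ℝ] EuclideanSpace ℝ X := e.symm.toLinearMap ∘ₗ L ∘ₗ e.toLinearMap
  have hT_apply : ∀ v x, T v x = L (e v) x := fun _ _ => rfl
  have hT : T.IsSymmetric := fun v w => by
    simp only [PiLp.inner_apply, hT_apply, RCLike.inner_apply, conj_trivial]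
    exact (Finset.sum_congr rfl fun x _ => mul_comm _ _).trans
      ((hsymm (e v) (e w)).trans (Finset.sum_congr rfl fun x _ => mul_comm _ _))
  let K : Submodule ℝ (EuclideanSpace ℝ X) :=
    { carrier := {v | ∑ x, v x = 0}
      add_mem' := fun {a b} ha hb => by
        simp only [Set.mem_ofPred_eq, PiLp.add_apply, Finset.sum_add_distrib] at *
        rw [ha, hb, add_zero]
      zero_mem' := by simp
      smul_mem' := fun c a ha => by
        simp only [Set.mem_ofPred_eq, PiLp.smul_apply, smul_eq_mul, ← Finset.mul_sum] at *
        rw [ha, mul_zero] }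
  have hK : ∀ v ∈ K, T v ∈ K := fun v _ => hL (e v)
  have hTK := hT.restrict_invariant hK
  let b := hTK.eigenvectorBasis rfl
  let v : K := ⟨e.symm f, hf⟩
  have hcoef : ∀ i, inner ℝ (T.restrict hK v) (b i) = hTK.eigenvalues rfl i * inner ℝ v (b i) :=
    fun i => by
      rw [hTK v (b i), hTK.apply_eigenvectorBasis rfl i, inner_smul_right]; rfl
  have hev : ∀ i, lam ≤ hTK.eigenvalues rfl i := fun i => by
    have hb := hTK.apply_eigenvectorBasis rfl i
    refine hlam (e (b i : EuclideanSpace ℝ X)) _ (fun h => ?_) (b i).2 ?_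
    · refine b.toBasis.ne_zero i ?_
      rw [OrthonormalBasis.coe_toBasis]
      exact Subtype.ext (e.map_eq_zero_iff.1 h)
    · exact congrArg (fun w : K => e (w : EuclideanSpace ℝ X)) hb
  have h1 : inner ℝ v v = ∑ x, f x ^ 2 := by
    change inner ℝ (e.symm f) (e.symm f) = _
    rw [PiLp.inner_apply]
    exact Finset.sum_congr rfl fun x _ => (sq (f x)).symm
  have h2 : inner ℝ (T.restrict hK v) v = ∑ x, f x * L f x := by
    change inner ℝ (T (e.symm f)) (e.symm f) = _
    simp [PiLp.inner_apply, T, e]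
  rw [← h1, ← h2, ← b.sum_inner_mul_inner, ← b.sum_inner_mul_inner, Finset.mul_sum]
  refine Finset.sum_le_sum fun i _ => ?_
  rw [hcoef, real_inner_comm v (b i)]
  nlinarith [hev i, mul_self_nonneg (inner ℝ v (b i))]

end Spectral

section Interchange

/-- Twice the Dirichlet form of the random walk with rates `c`. -/
def walkForm {n : ℕ} (c : Fin n → Fin n → ℝ) (u : Fin n → ℝ) : ℝ :=
  ∑ i, ∑ j, c i j * (u i - u j) ^ 2

/-- Twice the Dirichlet form of the interchange process with rates `c`. -/
def interchangeForm {n : ℕ} (c : Fin n → Fin n → ℝ) (f : Equiv.Perm (Fin n) → ℝ) : ℝ :=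
  ∑ i, ∑ j, c i j * (autocorr f 1 - autocorr f (Equiv.swap i j))

/-- The rates obtained by electrical reduction at the vertex `0`. -/
noncomputable def reducedRates {n : ℕ} (c : Fin (n + 1) → Fin (n + 1) → ℝ) (i j : Fin n) : ℝ :=
  c i.succ j.succ + c 0 i.succ * c 0 j.succ / ∑ k : Fin n, c 0 k.succ

lemma sum_sum_succ {n : ℕ} (F : Fin (n + 1) → Fin (n + 1) → ℝ) (hF : ∀ i j, F i j = F j i) :
    ∑ i, ∑ j, F i j = F 0 0 + 2 * ∑ i : Fin n, F 0 i.succ +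
      ∑ i : Fin n, ∑ j : Fin n, F i.succ j.succ := by
  simp only [Fin.sum_univ_succ, Finset.sum_add_distrib, hF (Fin.succ _) 0]
  ring

lemma sum_sum_mul_add {ι : Type*} [Fintype ι] (a x : ι → ℝ) :
    ∑ i, ∑ j, a i * a j * (x i + x j) = 2 * (∑ i, a i) * ∑ i, a i * x i := by
  have h1 : ∑ i, ∑ j, a i * a j * x i = (∑ i, a i) * ∑ i, a i * x i := by
    rw [mul_comm, Finset.sum_mul_sum]
    exact Finset.sum_congr rfl fun i _ => Finset.sum_congr rfl fun j _ => by ring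
  have h2 : ∑ i, ∑ j, a i * a j * x j = (∑ i, a i) * ∑ i, a i * x i := by
    rw [Finset.sum_mul_sum]
    exact Finset.sum_congr rfl fun i _ => Finset.sum_congr rfl fun j _ => by ring
  simp only [mul_add, Finset.sum_add_distrib, h1, h2]
  ring

variable {n : ℕ} {c : Fin (n + 1) → Fin (n + 1) → ℝ}

lemma walkForm_reducedRates (hsymm : ∀ i j, c i j = c j i) (hpos : ∀ i j, 0 ≤ c i j)
    (u : Fin n → ℝ) :
    ∃ h : ℝ, walkForm c (Fin.cons h u) = walkForm (reducedRates c) u := by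
  set a : Fin n → ℝ := fun i => c 0 i.succ with ha
  have hred : walkForm (reducedRates c) u = ∑ i : Fin n, ∑ j : Fin n,
      c i.succ j.succ * (u i - u j) ^ 2 +
        (∑ i, ∑ j, a i * a j * (u i - u j) ^ 2) / ∑ k, a k := by
    rw [walkForm, Finset.sum_div, ← Finset.sum_add_distrib]
    refine Finset.sum_congr rfl fun i _ => ?_
    rw [Finset.sum_div, ← Finset.sum_add_distrib]
    refine Finset.sum_congr rfl fun j _ => ?_
    rw [reducedRates]; ring
  have hsq : ∑ i, ∑ j, a i * a j * (u i - u j) ^ 2 =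
      2 * (∑ i, a i) * (∑ i, a i * u i ^ 2) - 2 * (∑ i, a i * u i) ^ 2 := by
    rw [← sum_sum_mul_add a fun i => u i ^ 2, sq (∑ i, a i * u i), Finset.sum_mul_sum,
      Finset.mul_sum, ← Finset.sum_sub_distrib]
    refine Finset.sum_congr rfl fun i _ => ?_
    rw [Finset.mul_sum, ← Finset.sum_sub_distrib]
    exact Finset.sum_congr rfl fun j _ => by ring
  have hwalk : ∀ h, walkForm c (Fin.cons h u) = 2 * ((∑ i, a i) * h ^ 2 -
      2 * h * (∑ i, a i * u i) + ∑ i, a i * u i ^ 2) + ∑ i : Fin n, ∑ j : Fin n,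
      c i.succ j.succ * (u i - u j) ^ 2 := fun h => by
    rw [walkForm, sum_sum_succ _ fun i j => by rw [hsymm i j]; ring]
    have h1 : ∑ i, a i * (h - u i) ^ 2 =
        (∑ i, a i) * h ^ 2 - 2 * h * (∑ i, a i * u i) + ∑ i, a i * u i ^ 2 := by
      rw [Finset.sum_mul, Finset.mul_sum, ← Finset.sum_sub_distrib, ← Finset.sum_add_distrib]
      exact Finset.sum_congr rfl fun i _ => by ring
    rw [← h1]
    simp [ha]
  rcases eq_or_ne (∑ i, a i) 0 with h0 | h0
  · have ha0 : ∀ i, a i = 0 := fun i =>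
      (Finset.sum_eq_zero_iff_of_nonneg fun i _ => hpos 0 i.succ).1 h0 i (Finset.mem_univ _)
    refine ⟨0, ?_⟩
    rw [hwalk, hred]
    simp [ha0]
  · refine ⟨(∑ i, a i * u i) / ∑ i, a i, ?_⟩
    rw [hwalk, hred, hsq]
    field_simp
    ring

lemma walkForm_sub_const (u : Fin n → ℝ) (c : Fin n → Fin n → ℝ) (t : ℝ) :
    walkForm c (fun i => u i - t) = walkForm c u := by
  simp [walkForm]

lemma walk_gap_reducedRates (hsymm : ∀ i j, c i j = c j i) (hpos : ∀ i j, 0 ≤ c i j) {lam : ℝ}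
    (hlam : 0 ≤ lam) (hgap : ∀ u, ∑ i, u i = 0 → lam * ∑ i, u i ^ 2 ≤ walkForm c u)
    (u : Fin n → ℝ) (hu : ∑ i, u i = 0) :
    lam * ∑ i, u i ^ 2 ≤ walkForm (reducedRates c) u := by
  obtain ⟨h, hh⟩ := walkForm_reducedRates hsymm hpos u
  have hn : (0 : ℝ) < n + 1 := by positivity
  have h1 := hgap (fun i => (Fin.cons h u : Fin (n + 1) → ℝ) i - h / (n + 1)) (by
    simp [Fin.sum_univ_succ, hu]
    field_simp
    ring)
  rw [walkForm_sub_const, hh] at h1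
  refine le_trans (mul_le_mul_of_nonneg_left ?_ hlam) h1
  have h2 : ∑ i : Fin n, (u i - h / (n + 1)) ^ 2 =
      ∑ i, u i ^ 2 + n * (h / (n + 1)) ^ 2 := by
    simp only [sub_sq, Finset.sum_add_distrib, Finset.sum_sub_distrib, ← Finset.mul_sum,
      ← Finset.sum_mul, hu]
    simp
  simp only [Fin.sum_univ_succ, Fin.cons_zero, Fin.cons_succ, h2]
  have : 0 ≤ (n : ℝ) * (h / (n + 1)) ^ 2 := by positivity
  nlinarith [sq_nonneg (h - h / (n + 1))]

lemma interchangeForm_reducedRates (hsymm : ∀ i j, c i j = c j i) (hpos : ∀ i j, 0 ≤ c i j)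
    (f : Equiv.Perm (Fin (n + 1)) → ℝ) :
    ∑ i : Fin n, ∑ j : Fin n, reducedRates c i j *
      (autocorr f 1 - autocorr f (Equiv.swap i.succ j.succ)) ≤ interchangeForm c f := by
  set a : Fin n → ℝ := fun i => c 0 i.succ with ha
  have hred : ∑ i : Fin n, ∑ j : Fin n, reducedRates c i j *
      (autocorr f 1 - autocorr f (Equiv.swap i.succ j.succ)) = ∑ i : Fin n, ∑ j : Fin n,
      c i.succ j.succ * (autocorr f 1 - autocorr f (Equiv.swap i.succ j.succ)) +
        (∑ i, ∑ j, a i * a j * (autocorr f 1 - autocorr f (Equiv.swap i.succ j.succ))) /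
          ∑ k, a k := by
    simp only [reducedRates, Finset.sum_div, ← Finset.sum_add_distrib]
    exact Finset.sum_congr rfl fun i _ => Finset.sum_congr rfl fun j _ => by ring
  have hoct := octopus f 0 (Fin.cons 0 a : Fin (n + 1) → ℝ)
    (Fin.cases le_rfl fun i => hpos 0 i.succ)
  simp only [Fin.sum_univ_succ, Fin.cons_zero, Fin.cons_succ, zero_mul, mul_zero,
    Finset.sum_const_zero, zero_add] at hoct
  have hsplit : ∑ i, ∑ j, a i * a j * octE (autocorr f) 0 i.succ j.succ =
      2 * (∑ i, a i) * ∑ i, a i * (autocorr f 1 - autocorr f (Equiv.swap 0 i.succ)) -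
      ∑ i, ∑ j, a i * a j * (autocorr f 1 - autocorr f (Equiv.swap i.succ j.succ)) := by
    rw [← sum_sum_mul_add, ← Finset.sum_sub_distrib]
    refine Finset.sum_congr rfl fun i _ => ?_
    rw [← Finset.sum_sub_distrib]
    exact Finset.sum_congr rfl fun j _ => by rw [octE]; ring
  rw [hred, interchangeForm, sum_sum_succ _ fun i j => by rw [hsymm i j, Equiv.swap_comm]]
  simp only [Equiv.swap_self, ← Equiv.Perm.one_def, sub_self, mul_zero, zero_add]
  rw [add_comm]
  refine add_le_add ?_ le_rfl
  have ha0 : 0 ≤ ∑ i, a i := Finset.sum_nonneg fun i _ => hpos 0 i.succ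
  rcases ha0.eq_or_lt with h0 | h0
  · have hz : ∀ i, a i = 0 := fun i =>
      (Finset.sum_eq_zero_iff_of_nonneg fun i _ => hpos 0 i.succ).1 h0.symm i (Finset.mem_univ _)
    rw [← h0, div_zero]
    refine mul_nonneg two_pos.le (Finset.sum_eq_zero fun i _ => ?_).ge
    rw [show c 0 i.succ = a i from rfl, hz, zero_mul]
  · rw [div_le_iff₀ h0]
    linarith

lemma decomposeFin_symm_mul (p : Fin (n + 1)) (σ τ : Equiv.Perm (Fin n)) :
    Equiv.Perm.decomposeFin.symm (p, σ) * Equiv.Perm.decomposeFin.symm (0, τ) =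
      Equiv.Perm.decomposeFin.symm (p, σ * τ) := by
  ext x
  refine Fin.cases ?_ (fun i => ?_) x <;> simp

lemma decomposeFin_symm_swap (i j : Fin n) :
    Equiv.Perm.decomposeFin.symm (0, Equiv.swap i j) = Equiv.swap i.succ j.succ := by
  ext x
  refine Fin.cases ?_ (fun k => ?_) x
  · rw [Equiv.swap_apply_of_ne_of_ne] <;> simp [Fin.succ_ne_zero, eq_comm]
  · simp [Equiv.swap_apply_def]
    split_ifs <;> rfl

/-- The restriction of a function on permutations to the fibre over `p` of evaluation at `0`. -/
def permFiber (f : Equiv.Perm (Fin (n + 1)) → ℝ) (p : Fin (n + 1)) (σ : Equiv.Perm (Fin n)) : ℝ :=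
  f (Equiv.Perm.decomposeFin.symm (p, σ))

lemma autocorr_permFiber (f : Equiv.Perm (Fin (n + 1)) → ℝ) (τ : Equiv.Perm (Fin n)) :
    autocorr f (Equiv.Perm.decomposeFin.symm (0, τ)) = ∑ p, autocorr (permFiber f p) τ := by
  rw [autocorr, ← Equiv.sum_comp Equiv.Perm.decomposeFin.symm, Fintype.sum_prod_type]
  simp [autocorr, permFiber, decomposeFin_symm_mul]

lemma sum_permFiber (f : Equiv.Perm (Fin (n + 1)) → ℝ) (p : Fin (n + 1)) :
    ∑ σ, permFiber f p σ = ∑ g with g 0 = p, f g := by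
  rw [Finset.sum_filter, ← Equiv.sum_comp Equiv.Perm.decomposeFin.symm, Fintype.sum_prod_type]
  simp [permFiber, Finset.sum_ite_irrel]

/-- The generator of the interchange process with rates `c`, up to a factor `-2`. -/
def interchangeOp {n : ℕ} (c : Fin n → Fin n → ℝ) :
    (Equiv.Perm (Fin n) → ℝ) →ₗ[ℝ] (Equiv.Perm (Fin n) → ℝ) where
  toFun f g := ∑ i, ∑ j, c i j * (f g - f (g * Equiv.swap i j))
  map_add' f f' := by
    ext g
    simp only [Pi.add_apply, ← Finset.sum_add_distrib]
    exact Finset.sum_congr rfl fun i _ => Finset.sum_congr rfl fun j _ => by ring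
  map_smul' t f := by
    ext g
    simp only [Pi.smul_apply, smul_eq_mul, Finset.mul_sum, RingHom.id_apply]
    exact Finset.sum_congr rfl fun i _ => Finset.sum_congr rfl fun j _ => by ring

lemma interchangeOp_apply {n : ℕ} (c : Fin n → Fin n → ℝ) (f : Equiv.Perm (Fin n) → ℝ) (g) :
    interchangeOp c f g = ∑ i, ∑ j, c i j * (f g - f (g * Equiv.swap i j)) := rfl

lemma sum_mul_interchangeOp {n : ℕ} (c : Fin n → Fin n → ℝ) (f w : Equiv.Perm (Fin n) → ℝ) :
    ∑ g, w g * interchangeOp c f g =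
      ∑ i, ∑ j, c i j * (∑ g, w g * f g - ∑ g, w g * f (g * Equiv.swap i j)) := by
  simp only [interchangeOp_apply, Finset.mul_sum]
  rw [Finset.sum_comm]
  refine Finset.sum_congr rfl fun i _ => ?_
  rw [Finset.sum_comm]
  refine Finset.sum_congr rfl fun j _ => ?_
  rw [← Finset.sum_sub_distrib, Finset.mul_sum]
  exact Finset.sum_congr rfl fun g _ => by ring

lemma sum_mul_swap {n : ℕ} (f w : Equiv.Perm (Fin n) → ℝ) (i j : Fin n) :
    ∑ g, w g * f (g * Equiv.swap i j) = ∑ g, w (g * Equiv.swap i j) * f g := by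
  rw [← Equiv.sum_comp (Equiv.mulRight (Equiv.swap i j))]
  simp [mul_assoc]

/-- The interchange process has spectral gap at least that of the random walk. -/
theorem interchange_gap : ∀ (n : ℕ) (c : Fin n → Fin n → ℝ), (∀ i j, c i j = c j i) →
    (∀ i j, 0 ≤ c i j) → ∀ lam : ℝ, 0 ≤ lam →
    (∀ u, ∑ i, u i = 0 → lam * ∑ i, u i ^ 2 ≤ walkForm c u) →
    ∀ f : Equiv.Perm (Fin n) → ℝ, ∑ g, f g = 0 → lam * ∑ g, f g ^ 2 ≤ interchangeForm c f := by
  intro n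
  induction n with
  | zero =>
    intro c _ _ lam _ _ f hf
    have h0 : f 1 = 0 := by simpa [Fintype.sum_subsingleton _ (1 : Equiv.Perm (Fin 0))] using hf
    simp [interchangeForm, h0]
  | succ n ih =>
    intro c hsymm hpos lam hlam hgap f hf
    have hform : ∀ f, ∑ g, f g * interchangeOp c f g = interchangeForm c f := fun f => by
      rw [sum_mul_interchangeOp, interchangeForm]
      simp [autocorr]
    rw [← hform]
    refine le_quadForm_of_eigenvalues (interchangeOp c) (fun f g => ?_) (fun f => ?_) lam ?_ f hf
    · simp only [mul_comm (interchangeOp c f _), sum_mul_interchangeOp]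
      refine Finset.sum_congr rfl fun i _ => Finset.sum_congr rfl fun j _ => ?_
      rw [sum_mul_swap]
      simp only [mul_comm]
    · have := sum_mul_interchangeOp c f 1
      simp only [sum_mul_swap] at this
      simpa using this
    clear f hf
    intro f μ hf0 hf hμ
    let U : Fin (n + 1) → Fin (n + 1) → ℝ := fun k i => ∑ g with g i = k, f g
    have hU0 : ∀ k, ∑ i, U k i = 0 := fun k => by
      simp only [U, Finset.sum_filter]
      rw [Finset.sum_comm]
      refine Eq.trans (Finset.sum_congr rfl fun g _ => ?_) hf
      rw [Equiv.sum_comp g fun i => if i = k then f g else 0]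
      simp
    have hU : ∀ k i, ∑ a, ∑ b, c a b * (U k i - U k (Equiv.swap a b i)) = μ * U k i := fun k i => by
      have h1 := sum_mul_interchangeOp c f fun g => if g i = k then 1 else 0
      rw [hμ] at h1
      simp only [sum_mul_swap] at h1
      simp only [U, Finset.sum_filter, Finset.mul_sum]
      simp only [Pi.smul_apply, smul_eq_mul, ite_mul, one_mul, zero_mul] at h1
      refine Eq.trans ?_ (h1.symm.trans ?_)
      · rfl
      · exact Finset.sum_congr rfl fun g _ => by simp
    have hUform : ∀ k, walkForm c (U k) = μ * ∑ i, U k i ^ 2 := fun k => by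
      have h1 : ∑ i, U k i * (μ * U k i) = μ * ∑ i, U k i ^ 2 := by
        rw [Finset.mul_sum]
        exact Finset.sum_congr rfl fun i _ => by ring
      rw [← h1, walkForm]
      simp only [← hU, Finset.mul_sum]
      symm
      rw [Finset.sum_comm]
      refine Finset.sum_congr rfl fun a _ => ?_
      rw [Finset.sum_comm]
      refine Finset.sum_congr rfl fun b _ => ?_
      rcases eq_or_ne a b with rfl | hab
      · simp
      rw [← Finset.sum_subset (Finset.subset_univ {a, b}), Finset.sum_pair hab]
      · simp; ring
      · intro i _ hi
        rw [Equiv.swap_apply_of_ne_of_ne] <;> simp_all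
    by_cases hUz : ∀ k, U k = 0
    · have hfib : ∀ p, ∑ σ, permFiber f p σ = 0 := fun p => by
        rw [sum_permFiber]; exact congrFun (hUz p) 0
      have hnorm : 0 < ∑ g, f g ^ 2 := by
        obtain ⟨g, hg⟩ := Function.ne_iff.1 hf0
        exact Finset.sum_pos' (fun _ _ => sq_nonneg _)
          ⟨g, Finset.mem_univ _, sq_pos_of_ne_zero hg⟩
      have h1 : interchangeForm c f = μ * ∑ g, f g ^ 2 := by
        rw [← hform, hμ, Finset.mul_sum]
        exact Finset.sum_congr rfl fun g _ => by simp; ring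
      have h2 := interchangeForm_reducedRates hsymm hpos f
      have h3 : ∑ i : Fin n, ∑ j : Fin n, reducedRates c i j *
          (autocorr f 1 - autocorr f (Equiv.swap i.succ j.succ)) =
          ∑ p, interchangeForm (reducedRates c) (permFiber f p) := by
        have hone : autocorr f 1 = ∑ p, autocorr (permFiber f p) 1 := by
          rw [← autocorr_permFiber, Equiv.Perm.decomposeFin_symm_of_one, Equiv.swap_self]; rfl
        simp only [interchangeForm]
        symm
        rw [Finset.sum_comm]
        refine Finset.sum_congr rfl fun i _ => ?_
        rw [Finset.sum_comm]
        refine Finset.sum_congr rfl fun j _ => ?_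
        rw [hone, ← decomposeFin_symm_swap, autocorr_permFiber, ← Finset.sum_sub_distrib,
          Finset.mul_sum]
      have h4 : lam * ∑ g, f g ^ 2 ≤ ∑ p, interchangeForm (reducedRates c) (permFiber f p) := by
        rw [← Equiv.sum_comp Equiv.Perm.decomposeFin.symm, Fintype.sum_prod_type, Finset.mul_sum]
        refine Finset.sum_le_sum fun p _ => ih (reducedRates c) (fun i j => ?_) (fun i j => ?_)
          lam hlam (walk_gap_reducedRates hsymm hpos hlam hgap) (permFiber f p) (hfib p)
        · simp only [reducedRates, hsymm i.succ, mul_comm]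
        · exact add_nonneg (hpos _ _) (div_nonneg (mul_nonneg (hpos _ _) (hpos _ _))
            (Finset.sum_nonneg fun _ _ => hpos _ _))
      exact le_of_mul_le_mul_right (by linarith) hnorm
    · push Not at hUz
      obtain ⟨k, hk⟩ := hUz
      obtain ⟨i, hi⟩ := Function.ne_iff.1 hk
      have hnorm : 0 < ∑ i, U k i ^ 2 := Finset.sum_pos' (fun _ _ => sq_nonneg _)
        ⟨i, Finset.mem_univ _, sq_pos_of_ne_zero hi⟩
      exact le_of_mul_le_mul_right ((hgap (U k) (hU0 k)).trans_eq (hUform k)) hnorm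

end Interchange

section Transfer

lemma swap_eq_swap_iff_of_ne {V : Type*} [DecidableEq V] {a b : V} (hab : a ≠ b) (i j : V) :
    Equiv.swap i j = Equiv.swap a b ↔ i = a ∧ j = b ∨ i = b ∧ j = a := by
  refine ⟨fun h => ?_, ?_⟩
  · have h1 := congrArg (fun σ : Equiv.Perm V => σ i) h
    have h2 := congrArg (fun σ : Equiv.Perm V => σ a) h
    simp only [Equiv.swap_apply_def] at h1 h2
    grind
  · rintro (⟨rfl, rfl⟩ | ⟨rfl, rfl⟩)
    · rfl
    · exact Equiv.swap_comm _ _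

lemma two_mul_sum_of_isSwap {V : Type*} [DecidableEq V] [Fintype V] (β : Equiv.Perm V → ℝ)
    (hβ : ∀ σ, β σ ≠ 0 → σ.IsSwap) : 2 * ∑ σ, β σ = ∑ i, ∑ j, β (Equiv.swap i j) := by
  have h1 : ∑ i, ∑ j, β (Equiv.swap i j) =
      ∑ σ, ∑ i, ∑ j, if Equiv.swap i j = σ then β σ else 0 := by
    symm
    rw [Finset.sum_comm]
    refine Finset.sum_congr rfl fun i _ => ?_
    rw [Finset.sum_comm]
    refine Finset.sum_congr rfl fun j _ => ?_
    simp
  rw [h1, Finset.mul_sum]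
  refine Finset.sum_congr rfl fun σ _ => ?_
  by_cases h : β σ = 0
  · simp [h]
  obtain ⟨a, b, hab, rfl⟩ := hβ σ h
  have h2 : ∀ i j, (if Equiv.swap i j = Equiv.swap a b then β (Equiv.swap a b) else 0) =
      (if i = a then if j = b then β (Equiv.swap a b) else 0 else 0) +
      (if i = b then if j = a then β (Equiv.swap a b) else 0 else 0) := fun i j => by
    rw [if_congr (swap_eq_swap_iff_of_ne hab i j) rfl rfl]
    grind
  simp [h2, Finset.sum_add_distrib, two_mul]

variable {n : ℕ} {α : Equiv.Perm (Fin n) → ℝ}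

/-- The rates of the transpositions under the weights `α`. -/
def swapRates (α : Equiv.Perm (Fin n) → ℝ) (i j : Fin n) : ℝ := α (Equiv.swap i j)

lemma two_mul_sum_mul_sub (hsupp : ∀ σ, α σ ≠ 0 → σ.IsSwap) (h : Equiv.Perm (Fin n) → ℝ) (t : ℝ) :
    2 * ∑ σ, α σ * h σ =
      2 * (∑ σ, α σ) * t - ∑ i, ∑ j, swapRates α i j * (t - h (Equiv.swap i j)) := by
  have h1 := two_mul_sum_of_isSwap (fun σ => α σ * (t - h σ)) fun σ hσ =>
    hsupp σ (left_ne_zero_of_mul hσ)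
  simp only [swapRates]
  rw [← h1]
  simp only [mul_sub, Finset.sum_sub_distrib, ← Finset.sum_mul]
  ring

lemma cayley_apply (hsupp : ∀ σ, α σ ≠ 0 → σ.IsSwap) (f : Equiv.Perm (Fin n) → ℝ)
    (g : Equiv.Perm (Fin n)) : ∑ h, α (g * h⁻¹) * f h = ∑ σ, α σ * f (σ * g) := by
  have hinv : ∀ σ, α σ⁻¹ = α σ := fun σ => by
    by_cases h : α σ = 0
    · by_contra h'
      obtain ⟨a, b, -, hab⟩ := hsupp _ (h ▸ h')
      rw [inv_eq_iff_eq_inv, Equiv.swap_inv] at hab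
      subst hab
      exact h' (by rw [Equiv.swap_inv])
    · obtain ⟨a, b, -, rfl⟩ := hsupp σ h
      rw [Equiv.swap_inv]
  rw [← Equiv.sum_comp (Equiv.mulRight g)]
  simp [hinv]

lemma cayley_quadForm (hsupp : ∀ σ, α σ ≠ 0 → σ.IsSwap) (f : Equiv.Perm (Fin n) → ℝ) :
    2 * ∑ g, (∑ h, α (g * h⁻¹) * f h) * f g =
      2 * (∑ σ, α σ) * (∑ g, f g ^ 2) - interchangeForm (swapRates α) fun g => f g⁻¹ := by
  have h1 : ∑ g, (∑ h, α (g * h⁻¹) * f h) * f g =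
      ∑ σ, α σ * autocorr (fun g => f g⁻¹) σ := by
    simp only [cayley_apply hsupp, Finset.sum_mul]
    rw [Finset.sum_comm]
    refine Finset.sum_congr rfl fun σ _ => ?_
    rw [← autocorr_inv, autocorr, Finset.mul_sum, ← Equiv.sum_comp (Equiv.inv _)]
    refine Finset.sum_congr rfl fun g _ => ?_
    simp only [Equiv.inv_apply, mul_inv_rev, inv_inv]
    ring
  have h2 : ∑ g, f g ^ 2 = autocorr (fun g => f g⁻¹) 1 := by
    rw [← Equiv.sum_comp (Equiv.inv _)]
    simp [autocorr, sq]
  rw [h1, h2, two_mul_sum_mul_sub hsupp]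
  rfl

lemma schreier_apply (hsupp : ∀ σ, α σ ≠ 0 → σ.IsSwap) (u : Fin n → ℝ) (i : Fin n) :
    ∑ j, schreierMatrix n α i j * u j = ∑ σ, α σ * u (σ i) := by
  have h1 : ∑ σ, α σ * u (σ i) = ∑ j, (∑ σ with σ i = j, α σ) * u j := by
    simp only [Finset.sum_mul, Finset.sum_filter]
    rw [Finset.sum_comm]
    simp
  rw [h1]
  refine Finset.sum_congr rfl fun j _ => ?_
  congr 1
  rw [schreierMatrix]
  split_ifs with hij
  · subst hij
    rw [Finset.sum_filter, Finset.sum_filter]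
    refine Finset.sum_congr rfl fun σ _ => ?_
    by_cases h : α σ = 0
    · simp [h]
    · simp [hsupp σ h]
  · rw [eq_comm]
    refine Finset.sum_eq_single_of_mem _ (by simp) fun σ hσ hne => ?_
    by_contra h
    obtain ⟨a, b, hab, rfl⟩ := hsupp σ h
    refine hne ?_
    have h2 := (Finset.mem_filter.1 hσ).2
    rw [eq_comm, swap_eq_swap_iff_of_ne hab]
    rw [Equiv.swap_apply_def] at h2
    grind

lemma sum_mul_swap_apply (u : Fin n → ℝ) (a b : Fin n) :
    ∑ i, u i * u (Equiv.swap a b i) = ∑ i, u i ^ 2 - (u a - u b) ^ 2 := by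
  rw [eq_sub_iff_add_eq', ← eq_sub_iff_add_eq, ← Finset.sum_sub_distrib]
  rcases eq_or_ne a b with rfl | hab
  · simp [sq]
  rw [← Finset.sum_subset (Finset.subset_univ {a, b}), Finset.sum_pair hab]
  · simp; ring
  · intro i _ hi
    rw [Equiv.swap_apply_of_ne_of_ne] <;> simp_all [sq]

lemma schreier_quadForm (hsupp : ∀ σ, α σ ≠ 0 → σ.IsSwap) (u : Fin n → ℝ) :
    2 * ∑ i, (∑ j, schreierMatrix n α i j * u j) * u i =
      2 * (∑ σ, α σ) * (∑ i, u i ^ 2) - walkForm (swapRates α) u := by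
  have h1 : ∑ i, (∑ j, schreierMatrix n α i j * u j) * u i =
      ∑ σ, α σ * ∑ i, u i * u (σ i) := by
    simp only [schreier_apply hsupp, Finset.sum_mul, Finset.mul_sum]
    rw [Finset.sum_comm]
    exact Finset.sum_congr rfl fun σ _ => Finset.sum_congr rfl fun i _ => by ring
  rw [h1, two_mul_sum_mul_sub hsupp _ (∑ i, u i ^ 2)]
  simp only [sum_mul_swap_apply, sub_sub_cancel, walkForm]

lemma sum_perm_apply (F : Fin n → ℝ) (k : Fin n) :
    ∑ g : Equiv.Perm (Fin n), F (g k) = (∑ i, F i) * Fintype.card (Equiv.Perm (Fin n)) / n := by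
  have h1 : ∀ l, ∑ g : Equiv.Perm (Fin n), F (g l) = ∑ g : Equiv.Perm (Fin n), F (g k) :=
    fun l => by
      rw [← Equiv.sum_comp (Equiv.mulRight (Equiv.swap k l))]
      simp
  have hn : (n : ℝ) ≠ 0 := Nat.cast_ne_zero.2 k.pos.ne'
  rw [eq_div_iff hn]
  have h2 : ∑ l, ∑ g : Equiv.Perm (Fin n), F (g l) =
      (∑ i, F i) * Fintype.card (Equiv.Perm (Fin n)) := by
    rw [Finset.sum_comm]
    simp [Equiv.sum_comp, mul_comm]
  rw [← h2]
  simp [h1, mul_comm]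

end Transfer

/-- **Aldous' spectral gap conjecture (weighted form), proved by
Caputo–Liggett–Richthammer.** For `α : S_n → ℝ` non-negative and supported on
transpositions, the second eigenvalue of the weighted Cayley graph (the supremum of the
Rayleigh quotient of `A_{g,h} = α(gh⁻¹)` over nonzero mean-zero functions on `S_n`) equals
the second eigenvalue of the weighted Schreier graph on `{1,…,n}` (the supremum of the
Rayleigh quotient of `B` over nonzero mean-zero vectors in `ℝⁿ`). -/
theorem aldous_spectral_gap (n : ℕ) (hn : 2 ≤ n) (α : Equiv.Perm (Fin n) → ℝ)
    (hpos : ∀ σ, 0 ≤ α σ) (hsupp : ∀ σ, α σ ≠ 0 → σ.IsSwap) :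
    sSup {r : ℝ | ∃ f : Equiv.Perm (Fin n) → ℝ, f ≠ 0 ∧ (∑ g, f g) = 0 ∧
        r = (∑ g, (∑ h, α (g * h⁻¹) * f h) * f g) / (∑ g, (f g) ^ 2)} =
    sSup {r : ℝ | ∃ u : Fin n → ℝ, u ≠ 0 ∧ (∑ i, u i) = 0 ∧
        r = (∑ i, (∑ j, schreierMatrix n α i j * u j) * u i) / (∑ i, (u i) ^ 2)} := by
  have hnorm : ∀ {X : Type} [Fintype X] {v : X → ℝ}, v ≠ 0 → 0 < ∑ x, v x ^ 2 := by
    intro X _ v hv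
    obtain ⟨x, hx⟩ := Function.ne_iff.1 hv
    exact Finset.sum_pos' (fun _ _ => sq_nonneg _) ⟨x, Finset.mem_univ _, sq_pos_of_ne_zero hx⟩
  set S₁ := {r : ℝ | ∃ f : Equiv.Perm (Fin n) → ℝ, f ≠ 0 ∧ (∑ g, f g) = 0 ∧
    r = (∑ g, (∑ h, α (g * h⁻¹) * f h) * f g) / (∑ g, (f g) ^ 2)}
  set S₂ := {r : ℝ | ∃ u : Fin n → ℝ, u ≠ 0 ∧ (∑ i, u i) = 0 ∧
    r = (∑ i, (∑ j, schreierMatrix n α i j * u j) * u i) / (∑ i, (u i) ^ 2)}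
  set Λ := ∑ σ, α σ
  let k : Fin n := ⟨0, by lia⟩
  have hk : k ≠ ⟨1, by lia⟩ := by simp [k]
  have hswap_symm : ∀ i j, swapRates α i j = swapRates α j i := fun i j => by
    rw [swapRates, swapRates, Equiv.swap_comm]
  have hswap_pos : ∀ i j, 0 ≤ swapRates α i j := fun i j => hpos _
  have hne : S₂.Nonempty := by
    refine ⟨_, Pi.single k 1 - Pi.single ⟨1, by lia⟩ 1, fun h => ?_, by simp, rfl⟩
    simpa [hk] using congrFun h k
  have hsub : S₂ ⊆ S₁ := by
    rintro _ ⟨u, hu0, hu, rfl⟩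
    have hfact : (0 : ℝ) < Fintype.card (Equiv.Perm (Fin n)) / n :=
      div_pos (Nat.cast_pos.2 Fintype.card_pos) (Nat.cast_pos.2 k.pos)
    have hsq : ∑ g : Equiv.Perm (Fin n), u (g k) ^ 2 =
      (∑ i, u i ^ 2) * (Fintype.card (Equiv.Perm (Fin n)) / n) := by
        rw [sum_perm_apply (fun i => u i ^ 2), mul_div_assoc]
    refine ⟨fun g => u (g k), fun h => ?_, by rw [sum_perm_apply, hu]; simp, ?_⟩
    · have := hnorm hu0
      have h0 : ∑ g : Equiv.Perm (Fin n), u (g k) ^ 2 = 0 :=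
        Finset.sum_eq_zero fun g _ => by rw [congrFun h g, Pi.zero_apply, sq, zero_mul]
      exact (mul_pos this hfact).ne' (hsq.symm.trans h0)
    have h1 : ∀ g, ∑ h, α (g * h⁻¹) * u (h k) = ∑ j, schreierMatrix n α (g k) j * u j := fun g => by
      rw [schreier_apply hsupp, cayley_apply hsupp fun g => u (g k)]
      rfl
    simp only [h1]
    rw [hsq, sum_perm_apply (fun i => (∑ j, schreierMatrix n α i j * u j) * u i), mul_div_assoc,
      mul_div_mul_right _ _ hfact.ne']
  have hbdd : BddAbove S₁ := by
    refine ⟨Λ, ?_⟩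
    rintro _ ⟨f, hf0, hf, rfl⟩
    rw [div_le_iff₀ (hnorm hf0)]
    have h1 := cayley_quadForm hsupp f
    have h2 := interchange_gap n (swapRates α) hswap_symm hswap_pos 0 le_rfl (fun u _ => by
      rw [zero_mul]
      exact Finset.sum_nonneg fun i _ => Finset.sum_nonneg fun j _ =>
        mul_nonneg (hswap_pos i j) (sq_nonneg _)) (fun g => f g⁻¹)
        ((Equiv.sum_comp (Equiv.inv _) f).trans hf)
    linarith
  have hwalk : ∀ u : Fin n → ℝ, ∑ i, u i = 0 → 2 * (Λ - sSup S₂) * ∑ i, u i ^ 2 ≤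
      walkForm (swapRates α) u := fun u hu => by
    rcases eq_or_ne u 0 with rfl | hu0
    · simp [walkForm]
    have h1 := le_csSup (hbdd.mono hsub) ⟨u, hu0, hu, rfl⟩
    rw [div_le_iff₀ (hnorm hu0)] at h1
    linarith [schreier_quadForm hsupp u]
  have hle : sSup S₂ ≤ Λ := by
    refine csSup_le hne ?_
    rintro _ ⟨u, hu0, hu, rfl⟩
    rw [div_le_iff₀ (hnorm hu0)]
    have h1 : 0 ≤ walkForm (swapRates α) u := Finset.sum_nonneg fun i _ =>
      Finset.sum_nonneg fun j _ => mul_nonneg (hswap_pos i j) (sq_nonneg _)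
    linarith [schreier_quadForm hsupp u]
  refine le_antisymm (csSup_le (hne.mono hsub) ?_) (csSup_le_csSup hbdd hne hsub)
  rintro _ ⟨f, hf0, hf, rfl⟩
  rw [div_le_iff₀ (hnorm hf0)]
  have h1 := interchange_gap n (swapRates α) hswap_symm hswap_pos _
    (mul_nonneg two_pos.le (sub_nonneg.2 hle)) hwalk (fun g => f g⁻¹)
    ((Equiv.sum_comp (Equiv.inv _) f).trans hf)
  rw [show ∑ g, f g⁻¹ ^ 2 = ∑ g, f g ^ 2 from Equiv.sum_comp (Equiv.inv _) fun g => f g ^ 2] at h1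
  linarith [cayley_quadForm hsupp f]
end
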